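/- arXiv:2501.02695 — 2 statements merged into one kernel-verified Lean document; each statement's English description precedes it below -/
import Mathlib

section
/- f(N) = π(N) + π(N^{1/2}) + o(π(N^{1/2})); that is, for every ε > 0 there exists N₀ ∈ ℕ such that for all N ≥ N₀, |f(N) − π(N) − π(N^{1/2})| ≤ ε·π(N^{1/2}). -/
/-- A set of positive integers has *distinct subset products* if any two distinct
finite subsets have distinct products (the empty product is `1`). -/
def DistinctSubsetProds (A : Set ℕ) : Prop :=
  ∀ B C : Finset ℕ, ↑B ⊆ A → ↑C ⊆ A → ∏ b ∈ B, b = ∏ c ∈ C, c → B = C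

/-- `primePi x` is the number of primes `p` with `(p : ℝ) ≤ x`. -/
noncomputable def primePi (x : ℝ) : ℕ := {p : ℕ | p.Prime ∧ (p : ℝ) ≤ x}.ncard

/-- `maxDSP N` is the size of the largest subset of `{1, …, N}` with distinct
subset products. -/
noncomputable def maxDSP (N : ℕ) : ℕ :=
  sSup {k | ∃ A : Finset ℕ, ↑A ⊆ Set.Icc 1 N ∧ DistinctSubsetProds ↑A ∧ A.card = k}


/-- The incidence vector of the edge `e` with endpoints `s e` and `t e` (loops count twice). -/
def incidence {ι V : Type*} [DecidableEq V] (s t : ι → V) (e : ι) : V → ℤ :=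
  Pi.single (s e) 1 + Pi.single (t e) 1

/-- No nonempty set of at most `L` edges of `E` carries a vanishing signed sum of incidence
vectors. -/
def ShortRelationFree {ι V : Type*} [DecidableEq V] (s t : ι → V) (E : Finset ι) (L : ℕ) : Prop :=
  ∀ F ⊆ E, F.card ≤ L → ∀ c : ι → ℤ, (∀ e ∈ F, c e = 1 ∨ c e = -1) →
    ∑ e ∈ F, c e • incidence s t e = 0 → F = ∅

/-- A rooted tree with edges in `E` and vertex set `B`, where `v` has depth at most `ℓ v`.
The signs `σ` and `τ` alternate along the tree. -/
structure AlternatingTree {ι V : Type*} [DecidableEq V] (s t : ι → V) (E : Finset ι)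
    (B : Finset V) (ℓ : V → ℕ) where
  root : V
  tree : Finset ι
  tree_sub : tree ⊆ E
  tree_mem : ∀ e ∈ tree, s e ∈ B ∧ t e ∈ B
  tree_card : tree.card ≤ B.card
  τ : ι → ℤ
  σ : V → ℤ
  τ_sign : ∀ e, τ e = 1 ∨ τ e = -1
  σ_sign : ∀ v, σ v = 1 ∨ σ v = -1
  path : V → Finset ι
  path_sub : ∀ v ∈ B, path v ⊆ tree
  path_card : ∀ v ∈ B, (path v).card ≤ ℓ v
  sum_path : ∀ v ∈ B, ∑ e ∈ path v, τ e • incidence s t e = Pi.single v (σ v) - Pi.single root 1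

section Graph

open Finset

variable {ι V : Type*} [DecidableEq ι] [DecidableEq V] {s t : ι → V} {E : Finset ι}
  {B S T : Finset V} {ℓ : V → ℕ} {L R : ℕ}

omit [DecidableEq ι] in
theorem ShortRelationFree.mono {E' : Finset ι} (h : ShortRelationFree s t E L) (hE : E' ⊆ E) :
    ShortRelationFree s t E' L :=
  fun F hF => h F (hF.trans hE)

namespace AlternatingTree

/-- The tree with a single vertex. -/
def single (s t : ι → V) (E : Finset ι) (v : V) : AlternatingTree s t E {v} (fun _ => 0) where
  root := v
  tree := ∅
  tree_sub := by simp
  tree_mem := by simp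
  tree_card := by simp
  τ := fun _ => 1
  σ := fun _ => 1
  τ_sign := by simp
  σ_sign := by simp
  path := fun _ => ∅
  path_sub := by simp
  path_card := by simp
  sum_path := by simp

/-- Enlarging the depth bound. -/
def mono {ℓ' : V → ℕ} (C : AlternatingTree s t E B ℓ) (h : ∀ v ∈ B, ℓ v ≤ ℓ' v) :
    AlternatingTree s t E B ℓ' :=
  { C with path_card := fun v hv => (C.path_card v hv).trans (h v hv) }

/-- Attaching the vertex `v` to the vertex `u` along the edge `e`. -/
def insertVertex (C : AlternatingTree s t E B ℓ) {u v : V} {e : ι} (hv : v ∉ B) (hu : u ∈ B)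
    (he : e ∈ E) (hj : (s e = u ∧ t e = v) ∨ (s e = v ∧ t e = u)) (hℓ : ℓ u + 1 ≤ ℓ v) :
    AlternatingTree s t E (insert v B) ℓ :=
  have hne : ∀ w ∈ B, w ≠ v := fun w hw h => hv (h ▸ hw)
  have het : e ∉ C.tree := fun h => by
    have := C.tree_mem e h
    rcases hj with ⟨h1, h2⟩ | ⟨h1, h2⟩ <;> simp_all
  have hsum : ∀ w ∈ B, ∑ f ∈ C.path w, (Function.update C.τ e (-C.σ u)) f • incidence s t f =
      Pi.single w (C.σ w) - Pi.single C.root 1 := fun w hw => by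
    rw [← C.sum_path w hw]
    refine sum_congr rfl fun f hf => ?_
    rw [Function.update_of_ne]
    rintro rfl
    exact het (C.path_sub w hw hf)
  { root := C.root
    tree := insert e C.tree
    tree_sub := insert_subset he C.tree_sub
    tree_mem := by
      intro f hf
      rcases mem_insert.1 hf with rfl | hf
      · rcases hj with ⟨h1, h2⟩ | ⟨h1, h2⟩ <;> simp [h1, h2, hu]
      · have := C.tree_mem f hf
        simp [this.1, this.2]
    tree_card := by
      rw [card_insert_of_notMem het, card_insert_of_notMem hv]
      exact Nat.succ_le_succ C.tree_card
    τ := Function.update C.τ e (-C.σ u)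
    σ := Function.update C.σ v (-C.σ u)
    τ_sign := by
      intro f
      by_cases hf : f = e
      · subst hf
        rcases C.σ_sign u with h | h <;> simp [h]
      · simpa [hf] using C.τ_sign f
    σ_sign := by
      intro w
      by_cases hw : w = v
      · subst hw
        rcases C.σ_sign u with h | h <;> simp [h]
      · simpa [hw] using C.σ_sign w
    path := Function.update C.path v (insert e (C.path u))
    path_sub := by
      intro w hw
      rcases mem_insert.1 hw with rfl | hw
      · simpa using insert_subset_insert e (C.path_sub u hu)
      · simpa [hne w hw] using (C.path_sub w hw).trans (subset_insert _ _)
    path_card := by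
      intro w hw
      rcases mem_insert.1 hw with rfl | hw
      · have := C.path_card u hu
        have := card_insert_le e (C.path u)
        simp only [Function.update_self]
        omega
      · simpa [hne w hw] using C.path_card w hw
    sum_path := by
      intro w hw
      rcases mem_insert.1 hw with rfl | hw
      · have hep : e ∉ C.path u := fun h => het (C.path_sub u hu h)
        simp only [Function.update_self]
        rw [sum_insert hep, hsum u hu, Function.update_self]
        have hi : incidence s t e = Pi.single u 1 + Pi.single w 1 := by
          rcases hj with ⟨h1, h2⟩ | ⟨h1, h2⟩ <;> simp [incidence, h1, h2, add_comm]
        rw [hi]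
        ext x
        by_cases hxu : x = u <;> by_cases hxw : x = w <;>
          simp [Pi.single_apply, hxu, hxw, hne u hu] <;> ring
      · simpa [hne w hw] using hsum w hw }

theorem nonempty_union (C : AlternatingTree s t E B fun _ => R) (X : Finset V)
    (hX : ∀ v ∈ X, ∃ u ∈ B, ∃ e ∈ E, (s e = u ∧ t e = v) ∨ (s e = v ∧ t e = u)) :
    Nonempty (AlternatingTree s t E (B ∪ X) fun _ => R + 1) := by
  suffices h : Nonempty (AlternatingTree s t E (B ∪ X) fun v => if v ∈ B then R else R + 1) by
    obtain ⟨D⟩ := h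
    exact ⟨D.mono fun v _ => by split_ifs <;> omega⟩
  induction X using Finset.induction_on with
  | empty =>
    rw [union_empty]
    exact ⟨C.mono fun v hv => by simp [hv]⟩
  | insert v X hv ih =>
    obtain ⟨D⟩ := ih fun w hw => hX w (mem_insert_of_mem hw)
    rw [union_insert]
    by_cases hvB : v ∈ B ∪ X
    · rw [insert_eq_of_mem hvB]
      exact ⟨D⟩
    · obtain ⟨u, hu, e, he, hj⟩ := hX v (mem_insert_self _ _)
      have : v ∉ B := fun h => hvB (mem_union_left _ h)
      exact ⟨D.insertVertex hvB (mem_union_left _ hu) he hj (by simp [hu, this])⟩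

theorem eq_zero_of_sum_eq (C : AlternatingTree s t E B fun _ => R)
    (hfree : ShortRelationFree s t E L) (hL : 2 * R + 2 ≤ L) {u v : V} (hu : u ∈ B) (hv : v ∈ B)
    {F : Finset ι} (hFE : F ⊆ E) (hFC : Disjoint F C.tree) (hF : F.card ≤ 2) {c : ι → ℤ}
    (hc : ∀ e ∈ F, c e = 1 ∨ c e = -1) {k : ℤ} (hk : k = 1 ∨ k = -1)
    (hsum : ∑ e ∈ F, c e • incidence s t e = k • (Pi.single u (C.σ u) - Pi.single v (C.σ v))) :
    F = ∅ := by
  set P := C.path u \ C.path v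
  set Q := C.path v \ C.path u
  have hPt : P ⊆ C.tree := sdiff_subset.trans (C.path_sub u hu)
  have hQt : Q ⊆ C.tree := sdiff_subset.trans (C.path_sub v hv)
  have hPQ : Disjoint P Q := by
    rw [disjoint_left]
    intro e h1 h2
    simp only [P, Q, mem_sdiff] at h1 h2
    exact h2.2 h1.1
  have hF1 : Disjoint F (P ∪ Q) := hFC.mono_right (union_subset hPt hQt)
  have hdiff : ∑ e ∈ P, C.τ e • incidence s t e - ∑ e ∈ Q, C.τ e • incidence s t e =
      Pi.single u (C.σ u) - Pi.single v (C.σ v) := by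
    have h1 := C.sum_path u hu
    have h2 := C.sum_path v hv
    rw [sum_sdiff_sub_sum_sdiff, h1, h2]
    abel
  have key := hfree (F ∪ (P ∪ Q))
    (union_subset hFE (union_subset (hPt.trans C.tree_sub) (hQt.trans C.tree_sub)))
    (by
      have h1 := card_union_le F (P ∪ Q)
      have h2 := card_union_le P Q
      have h3 : P.card ≤ R := (card_le_card sdiff_subset).trans (C.path_card u hu)
      have h4 : Q.card ≤ R := (card_le_card sdiff_subset).trans (C.path_card v hv)
      omega)
    (fun e => if e ∈ F then c e else if e ∈ P then -k * C.τ e else k * C.τ e)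
    (by
      intro e _
      split_ifs with h1 h2
      · exact hc e h1
      all_goals rcases hk with h | h <;> rcases C.τ_sign e with h' | h' <;> simp [h, h'])
    (by
      rw [sum_union hF1, sum_union hPQ]
      have e1 : ∑ e ∈ F, (if e ∈ F then c e else if e ∈ P then -k * C.τ e else k * C.τ e) •
          incidence s t e = ∑ e ∈ F, c e • incidence s t e :=
        sum_congr rfl fun e he => by simp [he]
      have e2 : ∑ e ∈ P, (if e ∈ F then c e else if e ∈ P then -k * C.τ e else k * C.τ e) •
          incidence s t e = -k • ∑ e ∈ P, C.τ e • incidence s t e := by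
        rw [smul_sum]
        refine sum_congr rfl fun e he => ?_
        have : e ∉ F := fun h => disjoint_left.1 hF1 h (mem_union_left _ he)
        simp [he, this, mul_smul]
      have e3 : ∑ e ∈ Q, (if e ∈ F then c e else if e ∈ P then -k * C.τ e else k * C.τ e) •
          incidence s t e = k • ∑ e ∈ Q, C.τ e • incidence s t e := by
        rw [smul_sum]
        refine sum_congr rfl fun e he => ?_
        have h1 : e ∉ F := fun h => disjoint_left.1 hF1 h (mem_union_right _ he)
        have h2 : e ∉ P := fun h => disjoint_left.1 hPQ h he
        simp [h1, h2, mul_smul]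
      rw [e1, e2, e3, hsum, ← hdiff, smul_sub, neg_smul]
      abel)
  exact (union_eq_empty.1 key).1

theorem card_edges_le (C : AlternatingTree s t E B fun _ => R)
    (hfree : ShortRelationFree s t E L) (hL : 2 * R + 2 ≤ L) (hS : ∀ e ∈ E, s e ∈ S) :
    (E.filter fun e => s e ∈ B ∧ t e ∈ B).card ≤ B.card + (B ∩ S).card := by
  set F := (E.filter fun e => s e ∈ B ∧ t e ∈ B) \ C.tree with hFdef
  have hmem : ∀ e ∈ F, e ∈ E ∧ (s e ∈ B ∧ t e ∈ B) ∧ e ∉ C.tree := fun e he => by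
    simp only [hFdef, mem_sdiff, mem_filter] at he
    tauto
  have hpar : ∀ e ∈ F, C.σ (s e) = C.σ (t e) := by
    intro e he
    obtain ⟨heE, ⟨hs, ht⟩, het⟩ := hmem e he
    by_contra hne
    have h := C.eq_zero_of_sum_eq hfree hL hs ht (F := {e}) (by simpa) (by simpa) (by simp)
      (c := fun _ => 1) (by simp) (C.σ_sign (s e)) (by
        have h2 : C.σ (t e) = -C.σ (s e) := by
          rcases C.σ_sign (s e) with h | h <;> rcases C.σ_sign (t e) with h' | h' <;> simp_all
        have h3 : C.σ (s e) * C.σ (s e) = 1 := by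
          rcases C.σ_sign (s e) with h | h <;> simp [h]
        ext x
        simp only [sum_singleton, one_smul, incidence, h2, Pi.add_apply, Pi.smul_apply,
          Pi.sub_apply, Pi.single_apply, smul_eq_mul]
        split_ifs <;> linarith)
    simp at h
  have hinj : Set.InjOn s F := by
    intro f hf g hg hfg
    by_contra hne
    obtain ⟨hfE, ⟨hfs, hft⟩, hfT⟩ := hmem f hf
    obtain ⟨hgE, ⟨hgs, hgt⟩, hgT⟩ := hmem g hg
    have h := C.eq_zero_of_sum_eq hfree hL hft hgt (F := {f, g})
      (by intro x; simp; rintro (rfl | rfl) <;> assumption)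
      (by simp [hfT, hgT]) (card_le_two)
      (c := fun e => if e = f then 1 else -1) (by intro e _; split_ifs <;> simp)
      (C.σ_sign (t f)) (by
        have h2 : C.σ (t g) = C.σ (t f) := by rw [← hpar f hf, ← hpar g hg, hfg]
        have h3 : C.σ (t f) * C.σ (t f) = 1 := by
          rcases C.σ_sign (t f) with h | h <;> simp [h]
        rw [sum_pair hne]
        ext x
        simp [h2, incidence, Pi.single_apply, Ne.symm hne, hfg]
        split_ifs <;> simp [h3])
    simp at h
  have h1 : F.card ≤ (B ∩ S).card :=
    card_le_card_of_injOn s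
      (fun e he => by
        obtain ⟨heE, ⟨hs, _⟩, _⟩ := hmem e he
        simp [hs, hS e heE]) hinj
  have h2 := le_card_sdiff C.tree (E.filter fun e => s e ∈ B ∧ t e ∈ B)
  rw [← hFdef] at h2
  have h3 := C.tree_card
  omega

end AlternatingTree

end Graph

section Balls

open Finset

variable {ι V : Type*} [DecidableEq ι] [DecidableEq V]

/-- The vertices of `T` joined to `B` by an edge ending in `T`. -/
def outerNbrs (s t : ι → V) (E : Finset ι) (T B : Finset V) : Finset V :=
  T.filter fun x => ∃ e ∈ E, s e ∈ B ∧ t e = x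

/-- The vertices of `S` that lie in `B` or are joined to `B` or to an outer neighbour of `B`. -/
def innerNbrs (s t : ι → V) (E : Finset ι) (S T B : Finset V) : Finset V :=
  S.filter fun x => x ∈ B ∨ ∃ e ∈ E, (s e ∈ B ∪ outerNbrs s t E T B ∧ t e = x) ∨
    (s e = x ∧ t e ∈ B ∪ outerNbrs s t E T B)

variable {s t : ι → V} {E : Finset ι} {B S T : Finset V} {L R : ℕ}

theorem AlternatingTree.nonempty_innerNbrs (hB : B ⊆ S)
    (h : Nonempty (AlternatingTree s t E (B ∪ outerNbrs s t E T B) fun _ => R)) :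
    Nonempty (AlternatingTree s t E (innerNbrs s t E S T B ∪ outerNbrs s t E T B)
      fun _ => R + 1) := by
  obtain ⟨C⟩ := h
  have h := C.nonempty_union (innerNbrs s t E S T B \ (B ∪ outerNbrs s t E T B)) (by
    intro v hv
    simp only [innerNbrs, mem_sdiff, mem_filter] at hv
    obtain ⟨⟨_, hv | ⟨e, he, ⟨h1, h2⟩ | ⟨h1, h2⟩⟩⟩, hvB⟩ := hv
    · exact absurd (mem_union_left _ hv) hvB
    · exact ⟨_, h1, e, he, .inl ⟨rfl, h2⟩⟩
    · exact ⟨_, h2, e, he, .inr ⟨h1, rfl⟩⟩)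
  have hBN : B ⊆ innerNbrs s t E S T B := fun x hx => mem_filter.2 ⟨hB hx, .inl hx⟩
  rwa [union_sdiff_self_eq_union, union_comm, ← union_assoc, union_eq_left.2 hBN] at h

theorem AlternatingTree.nonempty_outerNbrs {U : Finset V} (hU : U ⊆ outerNbrs s t E T B)
    (h : Nonempty (AlternatingTree s t E (B ∪ U) fun _ => R)) :
    Nonempty (AlternatingTree s t E (B ∪ outerNbrs s t E T B) fun _ => R + 1) := by
  obtain ⟨C⟩ := h
  have h := C.nonempty_union (outerNbrs s t E T B) (by
    intro v hv
    obtain ⟨_, e, he, h1, h2⟩ := mem_filter.1 hv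
    exact ⟨_, mem_union_left _ h1, e, he, .inl ⟨rfl, h2⟩⟩)
  rwa [union_assoc, union_eq_right.2 hU] at h

theorem nonempty_alternatingTree_ball {v : V} (hv : v ∈ S) (r : ℕ) :
    (innerNbrs s t E S T)^[r] {v} ⊆ S ∧
    Nonempty (AlternatingTree s t E ((innerNbrs s t E S T)^[r] {v} ∪
      outerNbrs s t E T ((innerNbrs s t E S T)^[r] {v})) fun _ => 2 * r + 1) := by
  induction r with
  | zero =>
    refine ⟨by simpa using hv, ?_⟩
    exact AlternatingTree.nonempty_outerNbrs (U := ∅) (by simp)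
      ⟨by simpa using AlternatingTree.single s t E v⟩
  | succ r ih =>
    obtain ⟨hB, hC⟩ := ih
    rw [Function.iterate_succ_apply']
    set B := (innerNbrs s t E S T)^[r] {v}
    refine ⟨filter_subset _ _, ?_⟩
    refine AlternatingTree.nonempty_outerNbrs (U := outerNbrs s t E T B) ?_
      (AlternatingTree.nonempty_innerNbrs hB hC)
    intro x hx
    obtain ⟨hxT, e, he, h1, h2⟩ := mem_filter.1 hx
    exact mem_filter.2 ⟨hxT, e, he, mem_filter.2 ⟨hB h1, .inl h1⟩, h2⟩

theorem exists_slow_growth {δ : ℝ} (hδ : 0 < δ) {v : V} (hv : v ∈ S)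
    (hR : (S.card : ℝ) < (1 + δ) ^ R) :
    ∃ r < R, (((innerNbrs s t E S T)^[r + 1] {v}).card : ℝ) ≤
      (1 + δ) * ((innerNbrs s t E S T)^[r] {v}).card := by
  by_contra! h
  have key : ∀ r ≤ R, (1 + δ) ^ r ≤ (((innerNbrs s t E S T)^[r] {v}).card : ℝ) := by
    intro r
    induction r with
    | zero => simp
    | succ r ih =>
      intro hr
      refine le_trans ?_ (h r hr).le
      rw [pow_succ']
      exact mul_le_mul_of_nonneg_left (ih (by omega)) (by positivity)
  have h1 := key R le_rfl
  have h2 : (((innerNbrs s t E S T)^[R] {v}).card : ℝ) ≤ S.card :=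
    Nat.cast_le.2 (card_le_card (nonempty_alternatingTree_ball hv R).1)
  linarith

/-- A multigraph on `S ∪ T` in which every edge meets `S`, and which has no short relation,
has at most about `#T + 2 #S` edges. -/
theorem ShortRelationFree.card_le {δ : ℝ} (hδ : 0 < δ) (hL : 4 * R + 6 ≤ L)
    (hfree : ShortRelationFree s t E L) (hdisj : Disjoint S T)
    (hs : ∀ e ∈ E, s e ∈ S) (ht : ∀ e ∈ E, t e ∈ S ∪ T) (hR : (S.card : ℝ) < (1 + δ) ^ R) :
    (E.card : ℝ) ≤ T.card + 2 * (1 + δ) * S.card := by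
  induction hn : S.card using Nat.strong_induction_on generalizing S T E with
  | _ n ih =>
  subst hn
  rcases S.eq_empty_or_nonempty with rfl | ⟨v, hv⟩
  · have : E = ∅ := eq_empty_of_forall_notMem fun e he => by simpa using hs e he
    simp [this]
  obtain ⟨r, hr, hgrow⟩ := exists_slow_growth (T := T) (t := t) (E := E) (s := s) hδ hv hR
  obtain ⟨hBS, hC⟩ := nonempty_alternatingTree_ball (T := T) (t := t) (E := E) (s := s) hv r
  have hvB : v ∈ (innerNbrs s t E S T)^[r] {v} := by
    clear hgrow hBS hC hr
    induction r with
    | zero => simp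
    | succ r ih =>
      rw [Function.iterate_succ_apply']
      exact mem_filter.2 ⟨hv, .inl ih⟩
  rw [Function.iterate_succ_apply'] at hgrow
  set B := (innerNbrs s t E S T)^[r] {v}
  set U := outerNbrs s t E T B with hU
  obtain ⟨C⟩ := AlternatingTree.nonempty_innerNbrs hBS hC
  have hUT : U ⊆ T := filter_subset _ _
  have hNS : innerNbrs s t E S T B ⊆ S := filter_subset _ _
  have hin := C.card_edges_le hfree (by omega) hs
  rw [← hU, card_union_of_disjoint (hdisj.mono hNS hUT), union_inter_distrib_right,
    inter_eq_left.2 hNS, disjoint_iff_inter_eq_empty.1 (hdisj.symm.mono_left hUT),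
    union_empty] at hin
  set E' := E.filter fun e => s e ∉ B ∪ U ∧ t e ∉ B ∪ U with hE'
  have hsplit : E.card ≤ E'.card + (E.filter fun e => s e ∈ innerNbrs s t E S T B ∪ U ∧
      t e ∈ innerNbrs s t E S T B ∪ U).card := by
    refine (card_le_card ?_).trans (card_union_le _ _)
    intro e he
    have hsU : s e ∉ U := fun h => disjoint_left.1 hdisj (hs e he) (hUT h)
    have hin : ∀ x ∈ B, x ∈ innerNbrs s t E S T B := fun x hx => mem_filter.2 ⟨hBS hx, .inl hx⟩
    rw [mem_union, mem_filter, mem_filter]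
    by_cases h : s e ∉ B ∪ U ∧ t e ∉ B ∪ U
    · exact .inl ⟨he, h⟩
    refine .inr ⟨he, ?_⟩
    by_cases hsB : s e ∈ B
    · refine ⟨mem_union_left _ (hin _ hsB), ?_⟩
      rcases mem_union.1 (ht e he) with h1 | h1
      · exact mem_union_left _ (mem_filter.2 ⟨h1, .inr ⟨e, he, .inl ⟨mem_union_left _ hsB, rfl⟩⟩⟩)
      · exact mem_union_right _ (mem_filter.2 ⟨h1, e, he, hsB, rfl⟩)
    · have htW : t e ∈ B ∪ U := by
        by_contra h'
        exact h ⟨by simp [hsB, hsU], h'⟩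
      refine ⟨mem_union_left _ (mem_filter.2 ⟨hs e he, .inr ⟨e, he, .inr ⟨rfl, htW⟩⟩⟩), ?_⟩
      rcases mem_union.1 htW with h1 | h1
      · exact mem_union_left _ (hin _ h1)
      · exact mem_union_right _ h1
  have hSB : (S \ B).card + B.card = S.card := card_sdiff_add_card_eq_card hBS
  have hTU : (T \ U).card + U.card = T.card := card_sdiff_add_card_eq_card hUT
  have hBpos : 0 < B.card := card_pos.2 ⟨v, hvB⟩
  have hrec := ih (S \ B).card (by omega) (E := E') (S := S \ B) (T := T \ U)
    (hfree.mono (filter_subset _ _))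
    (hdisj.mono sdiff_subset sdiff_subset)
    (fun e he => by
      obtain ⟨he, h1, h2⟩ := mem_filter.1 he
      exact mem_sdiff.2 ⟨hs e he, fun h => h1 (mem_union_left _ h)⟩)
    (fun e he => by
      obtain ⟨he, h1, h2⟩ := mem_filter.1 he
      have := ht e he
      simp only [mem_union, mem_sdiff] at *
      tauto)
    (lt_of_le_of_lt (Nat.cast_le.2 (by omega)) hR) rfl
  have h1 : (E.card : ℝ) ≤ E'.card + ((innerNbrs s t E S T B).card + U.card +
      (innerNbrs s t E S T B).card) := by exact_mod_cast hsplit.trans (by omega)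
  rify at hSB hTU
  rw [← hSB, ← hTU]
  linarith

end Balls

section Products

open Finset

/-- `∏ B` and `∏ C` have the same `p`-adic valuation for each prime `p > y`, and the sets `B`, `C`
are disjoint and not both empty. -/
structure IsRoughRelation (y : ℕ) (B C : Finset ℕ) : Prop where
  disjoint : Disjoint B C
  nonempty : (B ∪ C).Nonempty
  factorization_eq : ∀ p, p.Prime → y < p →
    (∏ b ∈ B, b).factorization p = (∏ c ∈ C, c).factorization p

theorem two_pow_card_le {N y : ℕ} {A : Finset ℕ} (hA : A ⊆ Icc 1 N)
    (hD : DistinctSubsetProds (A : Set ℕ)) {𝓕 : Finset (Finset ℕ × Finset ℕ)}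
    (hsub : ∀ P ∈ 𝓕, P.1 ∪ P.2 ⊆ A) (hrel : ∀ P ∈ 𝓕, IsRoughRelation y P.1 P.2)
    (hdisj : (𝓕 : Set (Finset ℕ × Finset ℕ)).PairwiseDisjoint fun P => P.1 ∪ P.2) :
    2 ^ 𝓕.card ≤ (N * N + 1) ^ y := by
  have hA0 : ∀ a ∈ A, a ≠ 0 := fun a ha => by have := mem_Icc.1 (hA ha); omega
  let part (𝓖 : Finset (Finset ℕ × Finset ℕ)) (P : Finset ℕ × Finset ℕ) : Finset ℕ :=
    if P ∈ 𝓖 then P.1 else P.2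
  let X (𝓖 : Finset (Finset ℕ × Finset ℕ)) : Finset ℕ := 𝓕.biUnion (part 𝓖)
  have hpart : ∀ 𝓖 P, part 𝓖 P ⊆ P.1 ∪ P.2 := by
    intro 𝓖 P
    simp only [part]
    split_ifs
    exacts [subset_union_left, subset_union_right]
  have hXA : ∀ 𝓖, X 𝓖 ⊆ A := fun 𝓖 => biUnion_subset.2 fun P hP => (hpart 𝓖 P).trans (hsub P hP)
  have hX0 : ∀ 𝓖, ∏ x ∈ X 𝓖, x ≠ 0 := fun 𝓖 => prod_ne_zero_iff.2 fun a ha => hA0 a (hXA 𝓖 ha)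
  have hlarge : ∀ 𝓖 p, p.Prime → y < p → (∏ x ∈ X 𝓖, x).factorization p =
      ∑ P ∈ 𝓕, (∏ b ∈ P.1, b).factorization p := by
    intro 𝓖 p hp hy
    rw [prod_biUnion (fun P hP Q hQ hPQ =>
        (hdisj hP hQ hPQ).mono (hpart 𝓖 P) (hpart 𝓖 Q)), Nat.factorization_prod_apply]
    · refine sum_congr rfl fun P hP => ?_
      simp only [part]
      split_ifs
      · rfl
      · exact ((hrel P hP).factorization_eq p hp hy).symm
    · exact fun P hP => prod_ne_zero_iff.2 fun a ha => hA0 a (hsub P hP (hpart 𝓖 P ha))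
  have hrecover : ∀ 𝓖 𝓗, X 𝓖 = X 𝓗 → ∀ P ∈ 𝓕, P ∈ 𝓖 → P ∈ 𝓗 := by
    intro 𝓖 𝓗 h P hP hPG
    by_contra hPH
    have hmem : ∀ 𝓘, ∀ x ∈ P.1 ∪ P.2, x ∈ X 𝓘 → x ∈ part 𝓘 P := by
      intro 𝓘 x hx hxX
      obtain ⟨Q, hQ, hxQ⟩ := mem_biUnion.1 hxX
      have : P = Q := by
        by_contra hPQ
        exact disjoint_left.1 (hdisj hP hQ hPQ) hx (hpart 𝓘 Q hxQ)
      rwa [this]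
    obtain ⟨x, hx⟩ := (hrel P hP).nonempty
    have hd := disjoint_left.1 (hrel P hP).disjoint
    have hG : part 𝓖 P = P.1 := if_pos hPG
    have hH : part 𝓗 P = P.2 := if_neg hPH
    rcases mem_union.1 hx with h1 | h2
    · have := hmem 𝓗 x hx (h ▸ mem_biUnion.2 ⟨P, hP, hG ▸ h1⟩)
      exact hd h1 (hH ▸ this)
    · have := hmem 𝓖 x hx (h ▸ mem_biUnion.2 ⟨P, hP, hH ▸ h2⟩)
      exact hd (hG ▸ this) h2
  rw [← card_powerset]
  have hcard : (Fintype.piFinset fun _ : Fin y => range (N * N + 1)).card = (N * N + 1) ^ y := by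
    simp
  rw [← hcard]
  refine card_le_card_of_injOn
    (fun 𝓖 (i : Fin y) => (∏ x ∈ X 𝓖, x).factorization (i + 1)) ?_ ?_
  · intro 𝓖 _
    refine Fintype.mem_piFinset.2 fun i => mem_range.2 (Nat.lt_succ_of_le ?_)
    dsimp only
    rw [Nat.factorization_prod_apply fun a ha => hA0 a (hXA 𝓖 ha)]
    refine (sum_le_card_nsmul _ _ N fun a ha => ?_).trans ?_
    · exact (Nat.factorization_lt _ (hA0 a (hXA 𝓖 ha))).le.trans (mem_Icc.1 (hA (hXA 𝓖 ha))).2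
    · rw [smul_eq_mul]
      refine Nat.mul_le_mul_right N ((card_le_card ((hXA 𝓖).trans hA)).trans ?_)
      simp
  · intro 𝓖 h𝓖 𝓗 h𝓗 heq
    have hX : X 𝓖 = X 𝓗 := by
      refine hD _ _ (by exact_mod_cast hXA 𝓖) (by exact_mod_cast hXA 𝓗) ?_
      refine Nat.eq_of_factorization_eq (hX0 𝓖) (hX0 𝓗) fun p => ?_
      by_cases hp : p.Prime
      · rcases lt_or_ge y p with hy | hy
        · rw [hlarge 𝓖 p hp hy, hlarge 𝓗 p hp hy]
        · have := congrFun heq ⟨p - 1, by have := hp.pos; omega⟩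
          simpa [Nat.sub_add_cancel hp.one_le] using this
      · simp [Nat.factorization_eq_zero_of_not_prime _ hp]
    ext P
    have h1 := mem_powerset.1 (mem_coe.1 h𝓖)
    have h2 := mem_powerset.1 (mem_coe.1 h𝓗)
    exact ⟨fun h => hrecover 𝓖 𝓗 hX P (h1 h) h, fun h => hrecover 𝓗 𝓖 hX.symm P (h2 h) h⟩

theorem exists_subset_without_rough_relations {N y : ℕ} {A : Finset ℕ} (hA : A ⊆ Icc 1 N)
    (hD : DistinctSubsetProds (A : Set ℕ)) (L : ℕ) :
    ∃ A' ⊆ A, ∃ M : ℕ, 2 ^ M ≤ (N * N + 1) ^ y ∧ A.card ≤ A'.card + L * M ∧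
      ∀ B C, B ∪ C ⊆ A' → (B ∪ C).card ≤ L → ¬ IsRoughRelation y B C := by
  classical
  let good (𝓕 : Finset (Finset ℕ × Finset ℕ)) : Prop :=
    (∀ P ∈ 𝓕, P.1 ∪ P.2 ⊆ A ∧ (P.1 ∪ P.2).card ≤ L ∧ IsRoughRelation y P.1 P.2) ∧
    (𝓕 : Set (Finset ℕ × Finset ℕ)).PairwiseDisjoint fun P => P.1 ∪ P.2
  obtain ⟨𝓕, h𝓕, hmax⟩ := exists_max_image
    (((A.powerset ×ˢ A.powerset).powerset).filter good) card
    ⟨∅, mem_filter.2 ⟨by simp, by simp [good]⟩⟩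
  obtain ⟨-, hgood, hdisj⟩ := mem_filter.1 h𝓕
  refine ⟨A \ 𝓕.biUnion fun P => P.1 ∪ P.2, sdiff_subset, 𝓕.card,
    two_pow_card_le hA hD (fun P hP => (hgood P hP).1) (fun P hP => (hgood P hP).2.2) hdisj, ?_, ?_⟩
  · have h1 := le_card_sdiff (𝓕.biUnion fun P => P.1 ∪ P.2) A
    have h2 := card_biUnion_le_card_mul 𝓕 (fun P => P.1 ∪ P.2) L fun P hP => (hgood P hP).2.1
    rw [mul_comm] at h2
    omega
  · intro B C hBC hL hrel
    have hnew : ∀ P ∈ 𝓕, Disjoint (B ∪ C) (P.1 ∪ P.2) := by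
      intro P hP
      rw [disjoint_left]
      intro x hx hxP
      exact (mem_sdiff.1 (hBC hx)).2 (mem_biUnion.2 ⟨P, hP, hxP⟩)
    have hnot : (B, C) ∉ 𝓕 := by
      intro h
      have := hnew _ h
      rw [disjoint_self_iff_empty] at this
      exact hrel.nonempty.ne_empty this
    have hins : good (insert (B, C) 𝓕) := by
      refine ⟨?_, ?_⟩
      · intro P hP
        rcases mem_insert.1 hP with rfl | hP
        · exact ⟨hBC.trans sdiff_subset, hL, hrel⟩
        · exact hgood P hP
      · rw [coe_insert]
        exact hdisj.insert fun P hP _ => hnew P hP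
    have := hmax (insert (B, C) 𝓕) (mem_filter.2 ⟨?_, hins⟩)
    · rw [card_insert_of_notMem hnot] at this
      omega
    · rw [mem_powerset]
      intro P hP
      have := (hins.1 P hP).1
      rw [mem_product, mem_powerset, mem_powerset]
      exact ⟨subset_union_left.trans this, subset_union_right.trans this⟩

theorem exists_endpoints {N y a : ℕ} (hy : N < (y + 1) ^ 3) (ha : a ∈ Icc 1 N) :
    ∃ q : ℕ × ℕ, q.1 ∈ insert 1 ((Icc 1 N.sqrt).filter Nat.Prime) ∧
      q.2 ∈ insert 1 ((Icc 1 N.sqrt).filter Nat.Prime) ∪ (Ioc N.sqrt N).filter Nat.Prime ∧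
      ∀ p, p.Prime → y < p →
        a.factorization p = (if q.1 = p then 1 else 0) + (if q.2 = p then 1 else 0) := by
  obtain ⟨ha1, haN⟩ := mem_Icc.1 ha
  set l := a.primeFactorsList.filter fun p => y < p with hl
  have hcount : ∀ p, p.Prime → y < p → a.factorization p = l.count p := by
    intro p _ hyp
    rw [hl, List.count_filter (by simpa using hyp), Nat.primeFactorsList_count_eq]
  have hprime : ∀ p ∈ l, p.Prime := fun p hp =>
    Nat.prime_of_mem_primeFactorsList (List.mem_of_mem_filter hp)
  have hgt : ∀ p ∈ l, y + 1 ≤ p := fun p hp => by simpa using List.of_mem_filter hp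
  have hprod : l.prod ≤ N := by
    refine le_trans (Nat.le_of_dvd ha1 ?_) haN
    conv_rhs => rw [← Nat.prod_primeFactorsList (Nat.pos_iff_ne_zero.1 ha1)]
    exact List.filter_sublist.prod_dvd_prod
  have hlen : l.length < 3 := by
    by_contra! h
    have h1 := List.pow_card_le_prod l (y + 1) hgt
    have h2 := Nat.pow_le_pow_right (n := y + 1) (by omega) h
    omega
  have hmem : ∀ p ∈ l, p ∈ insert 1 ((Icc 1 N.sqrt).filter Nat.Prime) ∪
      (Ioc N.sqrt N).filter Nat.Prime := by
    intro p hp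
    have h1 := (hprime p hp).one_le
    have h2 := (Nat.le_of_dvd (List.prod_pos fun q hq => (hprime q hq).pos)
      (List.dvd_prod hp)).trans hprod
    simp only [mem_union, mem_insert, mem_filter, mem_Icc, mem_Ioc, hprime p hp, and_true]
    omega
  clear_value l
  match l, hlen with
  | [], _ => exact ⟨(1, 1), by simp, by simp, fun p hp hyp => by
      simp [hcount p hp hyp, hp.ne_one.symm]⟩
  | [u], _ => exact ⟨(1, u), by simp, hmem u (by simp), fun p hp hyp => by
      simp [hcount p hp hyp, hp.ne_one.symm, List.count_cons]⟩
  | [u, v], _ =>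
    have huv : u * v ≤ N := by simpa using hprod
    have hsmall : ∀ w, w.Prime → w * w ≤ N →
        w ∈ insert 1 ((Icc 1 N.sqrt).filter Nat.Prime) := fun w hw h => by
      simp [hw, hw.one_le, Nat.le_sqrt.2 h]
    rcases le_total u v with h | h
    · refine ⟨(u, v), hsmall u (hprime u (by simp))
        ((Nat.mul_le_mul_left u h).trans huv), hmem v (by simp), fun p hp hyp => ?_⟩
      simp [hcount p hp hyp, List.count_cons, add_comm]
    · refine ⟨(v, u), hsmall v (hprime v (by simp))
        ((Nat.mul_le_mul_right v h).trans huv), hmem u (by simp), fun p hp hyp => ?_⟩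
      simp [hcount p hp hyp, List.count_cons]

theorem shortRelationFree_of_not_isRoughRelation {y L : ℕ} {A : Finset ℕ}
    (h0 : ∀ a ∈ A, a ≠ 0) {s t : ℕ → ℕ}
    (hst : ∀ a ∈ A, ∀ p, p.Prime → y < p →
      a.factorization p = (if s a = p then 1 else 0) + (if t a = p then 1 else 0))
    (hA : ∀ B C, B ∪ C ⊆ A → (B ∪ C).card ≤ L → ¬ IsRoughRelation y B C) :
    ShortRelationFree s t A L := by
  intro F hFA hFL c hc hsum
  by_contra hF
  have hne : ∀ e, c e = -1 → ¬ c e = 1 := by intros; omega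
  have hun : F.filter (fun e => c e = 1) ∪ F.filter (fun e => c e = -1) = F := by
    rw [← filter_or]
    exact filter_true_of_mem hc
  have hdisj : Disjoint (F.filter fun e => c e = 1) (F.filter fun e => c e = -1) :=
    disjoint_filter.2 fun e _ h h' => hne e h' h
  refine hA _ _ (hun.symm ▸ hFA) (hun.symm ▸ hFL)
    ⟨hdisj, hun.symm ▸ nonempty_iff_ne_empty.2 hF, fun p hp hyp => ?_⟩
  have hfac : ∀ a ∈ F, (a.factorization p : ℤ) = incidence s t a p := by
    intro a ha
    rw [hst a (hFA ha) p hp hyp]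
    simp [incidence, Pi.single_apply, eq_comm]
  rw [Nat.factorization_prod_apply fun a ha => h0 a (hFA (mem_filter.1 ha).1),
    Nat.factorization_prod_apply fun a ha => h0 a (hFA (mem_filter.1 ha).1)]
  have hp0 := congrFun hsum p
  rw [← hun, sum_union hdisj] at hp0
  simp only [Pi.add_apply, Finset.sum_apply, Pi.smul_apply, Pi.zero_apply] at hp0
  zify
  rw [sum_congr rfl fun a ha => hfac a (mem_filter.1 ha).1,
    sum_congr rfl fun a ha => hfac a (mem_filter.1 ha).1]
  rw [sum_congr rfl (g := fun a => incidence s t a p) fun a ha => by simp [(mem_filter.1 ha).2],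
    sum_congr rfl (s₁ := F.filter fun e => c e = -1) (g := fun a => -incidence s t a p)
      fun a ha => by simp [(mem_filter.1 ha).2], sum_neg_distrib] at hp0
  linarith

/-- The main upper bound, with explicit parameters. -/
theorem card_le_of_distinctSubsetProds {N y R : ℕ} {A : Finset ℕ} (hA : A ⊆ Icc 1 N)
    (hD : DistinctSubsetProds (A : Set ℕ)) (hy : N < (y + 1) ^ 3) {δ : ℝ} (hδ : 0 < δ)
    (hR : (N.sqrt : ℝ) + 1 < (1 + δ) ^ R) :
    ∃ M : ℕ, 2 ^ M ≤ (N * N + 1) ^ y ∧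
      (A.card : ℝ) ≤ ((Ioc N.sqrt N).filter Nat.Prime).card +
        2 * (1 + δ) * (((Icc 1 N.sqrt).filter Nat.Prime).card + 1) + (4 * R + 6) * M := by
  obtain ⟨A', hA', M, hM, hcard, hrel⟩ :=
    exists_subset_without_rough_relations (y := y) hA hD (4 * R + 6)
  have hex : ∀ a, ∃ q : ℕ × ℕ, a ∈ Icc 1 N → _ := fun a => by
    by_cases ha : a ∈ Icc 1 N
    · obtain ⟨q, hq⟩ := exists_endpoints hy ha
      exact ⟨q, fun _ => hq⟩
    · exact ⟨(0, 0), fun h => absurd h ha⟩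
  choose q hq using hex
  have hfree : ShortRelationFree (fun a => (q a).1) (fun a => (q a).2) A' (4 * R + 6) :=
    shortRelationFree_of_not_isRoughRelation (y := y)
      (fun a ha => by have := mem_Icc.1 (hA (hA' ha)); omega)
      (fun a ha => (hq a (hA (hA' ha))).2.2) hrel
  have hone : 1 ∉ (Icc 1 N.sqrt).filter Nat.Prime := by simp [Nat.not_prime_one]
  have hS : (insert 1 ((Icc 1 N.sqrt).filter Nat.Prime)).card =
      ((Icc 1 N.sqrt).filter Nat.Prime).card + 1 := card_insert_of_notMem hone
  have hdisj : Disjoint (insert 1 ((Icc 1 N.sqrt).filter Nat.Prime))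
      ((Ioc N.sqrt N).filter Nat.Prime) := by
    rw [disjoint_left]
    intro x hx hx'
    simp only [mem_insert, mem_filter, mem_Icc, mem_Ioc] at hx hx'
    rcases hx with rfl | hx
    · exact Nat.not_prime_one hx'.2
    · omega
  have hSR : ((insert 1 ((Icc 1 N.sqrt).filter Nat.Prime)).card : ℝ) < (1 + δ) ^ R := by
    refine lt_of_le_of_lt ?_ hR
    rw [hS]
    have : ((Icc 1 N.sqrt).filter Nat.Prime).card ≤ N.sqrt := (card_filter_le _ _).trans (by simp)
    push_cast
    gcongr
  have hmain := hfree.card_le hδ le_rfl hdisj (fun a ha => (hq a (hA (hA' ha))).1)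
    (fun a ha => (hq a (hA (hA' ha))).2.1) hSR
  refine ⟨M, hM, ?_⟩
  rw [hS] at hmain
  have : (A.card : ℝ) ≤ A'.card + (4 * R + 6) * M := by exact_mod_cast hcard
  push_cast at hmain
  linarith

end Products

section Asymptotics

open Finset Filter

theorem primePi_eq_card {x : ℝ} (hx : 0 ≤ x) :
    primePi x = ((Icc 1 ⌊x⌋₊).filter Nat.Prime).card := by
  rw [primePi, ← Set.ncard_coe_finset]
  congr 1
  ext p
  simp only [Set.mem_ofPred_eq, coe_filter, mem_Icc, Nat.le_floor_iff hx]
  exact ⟨fun h => ⟨⟨h.1.one_le, h.2⟩, h.1⟩, fun h => ⟨h.2, h.1.2⟩⟩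

theorem card_filter_prime_eq_primeCounting (n : ℕ) :
    ((Icc 1 n).filter Nat.Prime).card = Nat.primeCounting n := by
  rw [Nat.primeCounting, Nat.primeCounting', Nat.count_eq_card_filter_range]
  congr 1
  ext p
  simp only [mem_filter, mem_Icc, mem_range]
  exact ⟨fun h => ⟨by omega, h.2⟩, fun h => ⟨⟨h.2.one_le, by omega⟩, h.2⟩⟩

theorem card_filter_prime_Ioc_add (N : ℕ) :
    ((Ioc N.sqrt N).filter Nat.Prime).card + ((Icc 1 N.sqrt).filter Nat.Prime).card =
      ((Icc 1 N).filter Nat.Prime).card := by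
  rw [← card_union_of_disjoint, ← filter_union]
  · congr 2
    ext p
    have := N.sqrt_le_self
    simp only [mem_union, mem_Ioc, mem_Icc]
    omega
  · rw [disjoint_left]
    intro p hp hp'
    simp only [mem_filter, mem_Ioc, mem_Icc] at hp hp'
    omega

theorem distinctSubsetProds_primes_union_squares {A : Set ℕ}
    (hA : ∀ a ∈ A, a.Prime ∨ ∃ p, p.Prime ∧ a = p ^ 2) : DistinctSubsetProds A := by
  intro B C hB hC h
  have hA0 : ∀ a ∈ A, a ≠ 0 := by
    intro a ha
    rcases hA a ha with hp | ⟨p, hp, rfl⟩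
    · exact hp.ne_zero
    · exact pow_ne_zero 2 hp.ne_zero
  have hfac : ∀ a ∈ A, ∀ p, p.Prime →
      a.factorization p = (if a = p then 1 else 0) + (if a = p ^ 2 then 2 else 0) := by
    intro a ha p hp
    rcases hA a ha with hq | ⟨q, hq, rfl⟩
    · have : a ≠ p ^ 2 := fun h => Nat.Prime.not_prime_pow le_rfl (h ▸ hq)
      simp [hq.factorization, Finsupp.single_apply, this]
    · have h1 : q ^ 2 ≠ p := fun h => Nat.Prime.not_prime_pow le_rfl (h ▸ hp)
      have h2 : q ^ 2 = p ^ 2 ↔ q = p := Nat.pow_left_injective (n := 2) (by simp) |>.eq_iff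
      simp [hq.factorization, Finsupp.single_apply, h1, h2]
  have hprod : ∀ D : Finset ℕ, ↑D ⊆ A → ∀ p, p.Prime → (∏ d ∈ D, d).factorization p =
      (if p ∈ D then 1 else 0) + (if p ^ 2 ∈ D then 2 else 0) := by
    intro D hD p hp
    rw [Nat.factorization_prod_apply fun a ha => hA0 a (hD ha),
      sum_congr rfl fun a ha => hfac a (hD ha) p hp, sum_add_distrib]
    simp
  have hiff : ∀ p, p.Prime → ((p ∈ B ↔ p ∈ C) ∧ (p ^ 2 ∈ B ↔ p ^ 2 ∈ C)) := by
    intro p hp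
    have h1 := hprod B hB p hp
    rw [h, hprod C hC p hp] at h1
    by_cases hpB : p ∈ B <;> by_cases hpC : p ∈ C <;> by_cases hqB : p ^ 2 ∈ B <;>
      by_cases hqC : p ^ 2 ∈ C <;> simp_all
  have hmem : ∀ a ∈ A, a ∈ B ↔ a ∈ C := by
    intro a ha
    rcases hA a ha with hp | ⟨p, hp, rfl⟩
    exacts [(hiff a hp).1, (hiff p hp).2]
  ext a
  exact ⟨fun h => (hmem a (hB h)).1 h, fun h => (hmem a (hC h)).2 h⟩

theorem bddAbove_card_distinctSubsetProds (N : ℕ) :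
    BddAbove {k | ∃ A : Finset ℕ, ↑A ⊆ Set.Icc 1 N ∧ DistinctSubsetProds ↑A ∧ A.card = k} := by
  refine ⟨N, ?_⟩
  rintro k ⟨A, hA, -, rfl⟩
  have hA' : A ⊆ Icc 1 N := by rwa [← coe_subset, coe_Icc]
  simpa using card_le_card hA'

theorem le_maxDSP (N : ℕ) :
    ((Icc 1 N).filter Nat.Prime).card + ((Icc 1 N.sqrt).filter Nat.Prime).card ≤ maxDSP N := by
  set Q := ((Icc 1 N.sqrt).filter Nat.Prime).image fun p => p ^ 2
  have hQ : Q.card = ((Icc 1 N.sqrt).filter Nat.Prime).card :=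
    card_image_of_injective _ (Nat.pow_left_injective (n := 2) (by simp))
  have hmemQ : ∀ a ∈ Q, ∃ p, p.Prime ∧ 1 ≤ p ∧ p ≤ N.sqrt ∧ a = p ^ 2 := by
    intro a ha
    obtain ⟨p, hp, rfl⟩ := mem_image.1 ha
    simp only [mem_filter, mem_Icc] at hp
    exact ⟨p, hp.2, hp.1.1, hp.1.2, rfl⟩
  have hdisj : Disjoint ((Icc 1 N).filter Nat.Prime) Q := by
    rw [disjoint_left]
    intro a ha haQ
    obtain ⟨p, -, -, -, rfl⟩ := hmemQ a haQ
    exact Nat.Prime.not_prime_pow le_rfl (mem_filter.1 ha).2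
  rw [← hQ, ← card_union_of_disjoint hdisj]
  refine le_csSup (bddAbove_card_distinctSubsetProds N) ⟨_, ?_, ?_, rfl⟩
  · intro a ha
    rcases mem_union.1 (mem_coe.1 ha) with h | h
    · simpa using (mem_filter.1 h).1
    · obtain ⟨p, -, h1, h2, rfl⟩ := hmemQ a h
      exact ⟨Nat.one_le_pow _ _ h1, (Nat.pow_le_pow_left h2 2).trans N.sqrt_le'⟩
  · refine distinctSubsetProds_primes_union_squares fun a ha => ?_
    rcases mem_union.1 (mem_coe.1 ha) with h | h
    · exact .inl (mem_filter.1 h).2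
    · obtain ⟨p, hp, -, -, h⟩ := hmemQ a h
      exact .inr ⟨p, hp, h⟩

theorem exists_card_eq_maxDSP (N : ℕ) :
    ∃ A : Finset ℕ, A ⊆ Icc 1 N ∧ DistinctSubsetProds (A : Set ℕ) ∧ A.card = maxDSP N := by
  obtain ⟨A, hA, hD, hcard⟩ := Nat.sSup_mem (s := {k | ∃ A : Finset ℕ, ↑A ⊆ Set.Icc 1 N ∧
    DistinctSubsetProds ↑A ∧ A.card = k})
    ⟨0, ∅, by simp, distinctSubsetProds_primes_union_squares (by simp), rfl⟩
    (bddAbove_card_distinctSubsetProds N)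
  exact ⟨A, by rwa [← coe_subset, coe_Icc], hD, hcard⟩

theorem eventually_log_add_two_le {r : ℝ} (hr : 0 < r) :
    ∀ᶠ N : ℕ in atTop, Real.log ((N : ℝ) + 2) ≤ (N : ℝ) ^ r := by
  have h := ((isLittleO_log_rpow_atTop hr).bound (show (0 : ℝ) < 1 / 2 by norm_num))
  filter_upwards [tendsto_natCast_atTop_atTop.eventually h, eventually_ge_atTop 2] with N hN hN2
  have hN2' : (2 : ℝ) ≤ N := by exact_mod_cast hN2
  rw [Real.norm_of_nonneg (Real.log_nonneg (by linarith)),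
    Real.norm_of_nonneg (by positivity)] at hN
  have : Real.log ((N : ℝ) + 2) ≤ Real.log ((N : ℝ) ^ 2) :=
    Real.log_le_log (by linarith) (by nlinarith)
  rw [Real.log_pow] at this
  push_cast at this
  linarith

theorem primeCounting_sqrt_ge {N : ℕ} (hN : 4 ≤ N) :
    (Real.sqrt N - 1) * Real.log 2 - Real.log (N + 2) ≤
      Nat.primeCounting N.sqrt * Real.log (N + 2) := by
  have h2 : 2 ≤ N.sqrt := Nat.le_sqrt.2 hN
  have h2' : (2 : ℝ) ≤ N.sqrt := by exact_mod_cast h2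
  have hle : (N.sqrt : ℝ) ≤ N := by exact_mod_cast N.sqrt_le_self
  have h := Chebyshev.pi_ge N.sqrt
  rw [div_le_iff₀ (Real.log_pos (by linarith))] at h
  have h3 : Real.log (N.sqrt : ℝ) ≤ Real.log (N + 2) :=
    Real.log_le_log (by linarith) (by linarith)
  have h4 : Real.log ((N.sqrt : ℝ) + 1) ≤ Real.log (N + 2) :=
    Real.log_le_log (by linarith) (by linarith)
  have h5 : Real.sqrt N ≤ N.sqrt + 1 := Real.real_sqrt_le_nat_sqrt_succ
  have h6 := mul_le_mul_of_nonneg_left h3 (Nat.cast_nonneg (α := ℝ) (Nat.primeCounting N.sqrt))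
  have h7 : (Real.sqrt N - 1) * Real.log 2 ≤ N.sqrt * Real.log 2 :=
    mul_le_mul_of_nonneg_right (by linarith) (Real.log_nonneg (by norm_num))
  linarith

theorem two_pow_le_imp_le {N y M : ℕ} (h : 2 ^ M ≤ (N * N + 1) ^ y) :
    (M : ℝ) ≤ 2 / Real.log 2 * (y * Real.log (N + 2)) := by
  have hlog2 : 0 < Real.log 2 := Real.log_pos (by norm_num)
  have h' : ((2 : ℝ) ^ M) ≤ ((N : ℝ) + 2) ^ (2 * y) := by
    refine le_trans (b := ((N : ℝ) * N + 1) ^ y) (by exact_mod_cast h) ?_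
    rw [pow_mul]
    exact pow_le_pow_left₀ (by positivity) (by nlinarith [Nat.cast_nonneg (α := ℝ) N]) _
  have h1 := Real.log_le_log (by positivity) h'
  rw [Real.log_pow, Real.log_pow] at h1
  push_cast at h1
  rw [div_mul_eq_mul_div, le_div_iff₀ hlog2]
  linarith

theorem eventually_exists_parameters {δ η : ℝ} (hδ : 0 < δ) (hη : 0 < η) :
    ∀ᶠ N : ℕ in atTop, ∃ y R : ℕ, N < (y + 1) ^ 3 ∧ (N.sqrt : ℝ) + 1 < (1 + δ) ^ R ∧
      ∀ M : ℕ, 2 ^ M ≤ (N * N + 1) ^ y →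
        2 * (1 + δ) + (4 * R + 6) * M ≤ η * Nat.primeCounting N.sqrt := by
  have hlog2 : 0 < Real.log 2 := Real.log_pos (by norm_num)
  have hlog2' : Real.log 2 ≤ 1 := by linarith [Real.log_two_lt_d9]
  have hlam : 0 < Real.log (1 + δ) := Real.log_pos (by linarith)
  set a := 1 / Real.log (1 + δ) with ha
  set b := 2 / Real.log 2 with hb
  have ha0 : 0 < a := by positivity
  have hb0 : 0 < b := by positivity
  set K := (2 * (1 + δ) + (4 * a + 10) * b + 2 * η) / (η * Real.log 2) with hK
  have hz := (tendsto_rpow_atTop (show (0 : ℝ) < 1 / 60 by norm_num)).comp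
    (tendsto_natCast_atTop_atTop (R := ℝ))
  filter_upwards [eventually_log_add_two_le (show (0 : ℝ) < 1 / 60 by norm_num),
    hz.eventually_ge_atTop K, eventually_ge_atTop 4] with N hlog hzK hN4
  simp only [Function.comp_apply] at hzK
  have hN1 : (4 : ℝ) ≤ N := by exact_mod_cast hN4
  have hN0 : (0 : ℝ) ≤ N := by linarith
  set z := (N : ℝ) ^ ((1 : ℝ) / 60) with hzdef
  have hz1 : 1 ≤ z := Real.one_le_rpow (by linarith) (by norm_num)
  have hz20 : (N : ℝ) ^ ((1 : ℝ) / 3) = z ^ 20 := by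
    rw [hzdef, ← Real.rpow_natCast, ← Real.rpow_mul hN0]; norm_num
  have hz30 : Real.sqrt N = z ^ 30 := by
    rw [Real.sqrt_eq_rpow, hzdef, ← Real.rpow_natCast, ← Real.rpow_mul hN0]; norm_num
  have hl1 : 0 < Real.log ((N : ℝ) + 2) := Real.log_pos (by linarith)
  refine ⟨⌊(N : ℝ) ^ ((1 : ℝ) / 3)⌋₊, ⌊a * Real.log (N + 2)⌋₊ + 1, ?_, ?_, ?_⟩
  · have h := Nat.lt_floor_add_one ((N : ℝ) ^ ((1 : ℝ) / 3))
    have h3 : (((N : ℝ) ^ ((1 : ℝ) / 3)) ^ 3 : ℝ) = N := by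
      rw [← Real.rpow_natCast, ← Real.rpow_mul hN0]; norm_num
    have := pow_lt_pow_left₀ h (by positivity) (show 3 ≠ 0 by norm_num)
    rw [h3] at this
    exact_mod_cast this
  · have h := Nat.lt_floor_add_one (a * Real.log (N + 2))
    have h1 : Real.log (N + 2) < (⌊a * Real.log (N + 2)⌋₊ + 1 : ℕ) * Real.log (1 + δ) := by
      have h2 := mul_lt_mul_of_pos_right h hlam
      have h3 : a * Real.log (N + 2) * Real.log (1 + δ) = Real.log (N + 2) := by
        rw [ha]; field_simp
      rw [h3] at h2
      exact_mod_cast h2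
    rw [← Real.log_pow] at h1
    have h2 := (Real.log_lt_log_iff (by linarith) (by positivity)).1 h1
    have : (N.sqrt : ℝ) ≤ N := by exact_mod_cast N.sqrt_le_self
    linarith
  · intro M hM
    have hM' := two_pow_le_imp_le hM
    have hR : ((⌊a * Real.log (N + 2)⌋₊ + 1 : ℕ) : ℝ) ≤ a * z + 1 := by
      push_cast
      have h1 := Nat.floor_le (show 0 ≤ a * Real.log ((N : ℝ) + 2) by positivity)
      have h2 := mul_le_mul_of_nonneg_left hlog ha0.le
      linarith
    have hy : ((⌊(N : ℝ) ^ ((1 : ℝ) / 3)⌋₊ : ℕ) : ℝ) ≤ z ^ 20 :=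
      (Nat.floor_le (by positivity)).trans hz20.le
    have hM2 : (M : ℝ) ≤ b * (z ^ 20 * z) := by
      refine hM'.trans (mul_le_mul_of_nonneg_left ?_ hb0.le)
      exact mul_le_mul hy hlog hl1.le (by positivity)
    have hprod : (4 * ((⌊a * Real.log (N + 2)⌋₊ + 1 : ℕ) : ℝ) + 6) * M ≤
        (4 * (a * z + 1) + 6) * (b * (z ^ 20 * z)) :=
      mul_le_mul (by linarith) hM2 (by positivity) (by positivity)
    set G := 2 * (1 + δ) + (4 * (a * z + 1) + 6) * (b * (z ^ 20 * z)) with hG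
    have hG0 : 0 < G := by positivity
    refine le_trans (b := G) (by rw [hG]; linarith) ?_
    have hpi := primeCounting_sqrt_ge hN4
    rw [hz30] at hpi
    have hKz : 2 * (1 + δ) + (4 * a + 10) * b + 2 * η ≤ z * (η * Real.log 2) := by
      rwa [hK, div_le_iff₀ (by positivity)] at hzK
    have hpow : ∀ k, k ≤ 23 → z ^ k ≤ z ^ 23 := fun k hk => pow_le_pow_right₀ hz1 hk
    have hpoly : G * z + η * (Real.log 2 + z) ≤ η * (z ^ 30 * Real.log 2) := by
      calc G * z + η * (Real.log 2 + z)
          = 2 * (1 + δ) * z ^ 1 + 4 * a * b * z ^ 23 + 10 * b * z ^ 22 +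
            η * (Real.log 2 * z ^ 0 + z ^ 1) := by rw [hG]; ring
        _ ≤ 2 * (1 + δ) * z ^ 23 + 4 * a * b * z ^ 23 + 10 * b * z ^ 23 +
            η * (1 * z ^ 23 + z ^ 23) := by
          gcongr <;> norm_num
        _ = (2 * (1 + δ) + (4 * a + 10) * b + 2 * η) * z ^ 23 := by ring
        _ ≤ z * (η * Real.log 2) * z ^ 23 := by gcongr
        _ = η * (z ^ 24 * Real.log 2) := by ring
        _ ≤ η * (z ^ 30 * Real.log 2) := by gcongr; norm_num
    have hfin : G * Real.log (N + 2) ≤ η * Nat.primeCounting N.sqrt * Real.log (N + 2) := by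
      have h1 := mul_le_mul_of_nonneg_left hlog hG0.le
      have h2 := mul_le_mul_of_nonneg_left hpi hη.le
      have h3 := mul_le_mul_of_nonneg_left hlog hη.le
      linarith
    exact le_of_mul_le_mul_right hfin hl1

end Asymptotics

/-- `f(N) = π(N) + π(N^{1/2}) + o(π(N^{1/2}))`. -/
theorem stmt1 : ∀ ε : ℝ, 0 < ε → ∃ N₀ : ℕ, ∀ N : ℕ, N₀ ≤ N →
    |(maxDSP N : ℝ) - primePi N - primePi ((N : ℝ) ^ ((1 : ℝ) / 2))| ≤
      ε * primePi ((N : ℝ) ^ ((1 : ℝ) / 2)) := by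
  intro ε hε
  obtain ⟨N₀, hN₀⟩ := Filter.eventually_atTop.1
    (eventually_exists_parameters (δ := ε / 4) (η := ε / 2) (by positivity) (by positivity))
  refine ⟨N₀, fun N hN => ?_⟩
  obtain ⟨y, R, hy, hR, hM⟩ := hN₀ N hN
  obtain ⟨A, hA, hD, hcard⟩ := exists_card_eq_maxDSP N
  obtain ⟨M, hMle, hAle⟩ := card_le_of_distinctSubsetProds hA hD hy (by positivity) hR
  have hbound := hM M hMle
  have hlower := le_maxDSP N
  have hsplit := card_filter_prime_Ioc_add N
  rw [primePi_eq_card (Nat.cast_nonneg N), primePi_eq_card (by positivity), Nat.floor_natCast,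
    ← Real.sqrt_eq_rpow, Real.nat_floor_real_sqrt_eq_nat_sqrt]
  rw [hcard] at hAle
  rw [← card_filter_prime_eq_primeCounting] at hbound
  rify at hlower hsplit
  rw [abs_of_nonneg (by linarith)]
  linarith
end

section
/- For every ε > 0 there exists a constant C > 0 such that for all N ∈ ℕ, h(N) ≤ π(N) + (1/2)·π(N^{1/2}) + C·N^{5/12+ε}, where h(N) is the maximal size of a subset of [N] consisting of squarefree integers with distinct subset products. -/
/-- `maxSqfreeDSP N` is the maximal size of a subset of `{1, …, N}` consisting of
squarefree integers and having distinct subset products. -/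
noncomputable def maxSqfreeDSP (N : ℕ) : ℕ :=
  sSup {k | ∃ A : Finset ℕ, ↑A ⊆ Set.Icc 1 N ∧ (∀ a ∈ A, Squarefree a) ∧
    DistinctSubsetProds ↑A ∧ A.card = k}

section Walks

open SimpleGraph

lemma exists_even_closed_trail_of_ear {V : Type*} [DecidableEq V] {G : SimpleGraph V} {z₀ z₁ z₂ : V}
    (c : G.Walk z₀ z₀) (hc : c.IsTrail) (hodd : Odd c.length) (h₁ : z₁ ∈ c.support)
    (h₂ : z₂ ∈ c.support) (q : G.Walk z₁ z₂) (hq : q.IsTrail) (hq0 : 0 < q.length)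
    (hdisj : ∀ e ∈ q.edges, e ∉ c.edges) :
    ∃ d : G.Walk z₁ z₁, d.IsTrail ∧ 0 < d.length ∧ d.length ≤ c.length + q.length ∧
      Even d.length := by
  have hperm : (c.rotate z₁ h₁).edges.Perm c.edges := (c.rotate_edges z₁ h₁).perm
  have hlen : (c.rotate z₁ h₁).length = c.length := by
    rw [← Walk.length_edges, ← Walk.length_edges, hperm.length_eq]
  have h₂' : z₂ ∈ (c.rotate z₁ h₁).support := by
    simpa using h₂
  have hr : (c.rotate z₁ h₁).IsTrail := hc.rotate h₁
  have hdisj' : ∀ e ∈ q.edges, e ∉ (c.rotate z₁ h₁).edges := fun e he h =>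
    hdisj e he (hperm.subset h)
  generalize c.rotate z₁ h₁ = c' at *
  obtain ⟨p, s, rfl⟩ := Walk.mem_support_iff_exists_append.mp h₂'
  have hp : p.IsTrail := hr.of_append_left
  have hs : s.IsTrail := hr.of_append_right
  rw [Walk.length_append] at hlen
  rw [Nat.odd_iff] at hodd
  rw [Walk.edges_append] at hdisj'
  rcases Nat.even_or_odd (q.length + p.length) with h | h
  · refine ⟨q.append p.reverse, ?_, ?_, ?_, ?_⟩
    · rw [Walk.isTrail_def, Walk.edges_append, List.nodup_append']
      refine ⟨hq.edges_nodup, hp.reverse.edges_nodup, fun e he he' => hdisj' e he ?_⟩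
      simp at he' ⊢
      exact Or.inl he'
    · simp; omega
    · simp; omega
    · simpa using h
  · refine ⟨q.append s, ?_, ?_, ?_, ?_⟩
    · rw [Walk.isTrail_def, Walk.edges_append, List.nodup_append']
      refine ⟨hq.edges_nodup, hs.edges_nodup, fun e he he' => hdisj' e he ?_⟩
      simp at he' ⊢
      exact Or.inr he'
    · simp; omega
    · simp; omega
    · rw [Nat.even_iff, Walk.length_append]
      rw [Nat.odd_iff] at h
      omega

lemma SimpleGraph.Walk.exists_append_first_mem {V : Type*} {G : SimpleGraph V} (S : Set V) :
    ∀ {u x : V} (w : G.Walk u x), (∃ y ∈ w.support, y ∈ S) →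
      ∃ z ∈ S, ∃ (w₁ : G.Walk u z) (w₂ : G.Walk z x), w = w₁.append w₂ ∧
        ∀ e ∈ w₁.edges, ∃ y ∈ e, y ∉ S
  | u, _, .nil => by
    rintro ⟨y, hy, hyS⟩
    simp at hy
    subst hy
    exact ⟨y, hyS, .nil, .nil, rfl, by simp⟩
  | u, _, .cons h p => by
    rintro ⟨y, hy, hyS⟩
    by_cases hu : u ∈ S
    · exact ⟨u, hu, .nil, .cons h p, rfl, by simp⟩
    · have : ∃ y ∈ p.support, y ∈ S := by
        rw [Walk.support_cons, List.mem_cons] at hy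
        rcases hy with rfl | hy
        · exact absurd hyS hu
        · exact ⟨y, hy, hyS⟩
      obtain ⟨z, hz, w₁, w₂, rfl, hw⟩ := exists_append_first_mem S p this
      refine ⟨z, hz, .cons h w₁, w₂, rfl, ?_⟩
      intro e he
      rw [Walk.edges_cons, List.mem_cons] at he
      rcases he with rfl | he
      · exact ⟨u, by simp, hu⟩
      · exact hw e he

lemma exists_even_closed_trail_of_meet {V : Type*} [DecidableEq V] {G T : SimpleGraph V}
    (hT : T ≤ G)
    {a b a' b' x : V} (hab : G.Adj a b) (hab' : G.Adj a' b') (hTab : ¬ T.Adj a b)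
    (hTab' : ¬ T.Adj a' b') (hne : s(a, b) ≠ s(a', b')) (p : T.Walk b a) (hp : p.IsTrail)
    (p' : T.Walk b' a') (hp' : p'.IsTrail) (hpe : Even p.length) (hx : x ∈ p.support)
    (hx' : x ∈ p'.support) :
    ∃ (z : V) (d : G.Walk z z), d.IsTrail ∧ 0 < d.length ∧
      d.length ≤ p.length + p'.length + 2 ∧ Even d.length := by
  have hnp : ∀ {u v : V} (w : T.Walk u v), s(a, b) ∉ w.edges := fun w h =>
    hTab (w.adj_of_mem_edges h)
  have hnp' : ∀ {u v : V} (w : T.Walk u v), s(a', b') ∉ w.edges := fun w h =>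
    hTab' (w.adj_of_mem_edges h)
  let c : G.Walk a a := .cons hab (p.mapLe hT)
  have hc : c.IsTrail := by
    rw [Walk.isTrail_def]
    simp only [c, Walk.edges_cons, Walk.edges_mapLe_eq_edges, List.nodup_cons]
    exact ⟨hnp p, hp.edges_nodup⟩
  have hcl : c.length = p.length + 1 := by simp [c]
  have hcs : ∀ y, y ∈ c.support ↔ y ∈ p.support := by
    intro y
    simp only [c, Walk.support_cons, Walk.support_mapLe_eq_support, List.mem_cons,
      or_iff_right_iff_imp]
    rintro rfl
    simp
  have hce : ∀ e, e ∈ c.edges ↔ e = s(a, b) ∨ e ∈ p.edges := by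
    intro e; simp [c]
  obtain ⟨z₂, hz₂, w₁, w₂, rfl, hw₁⟩ :=
    p'.exists_append_first_mem {y | y ∈ p.support} ⟨x, hx', hx⟩
  obtain ⟨z₁, hz₁, w₃, w₄, hw, hw₃⟩ :=
    w₂.reverse.exists_append_first_mem {y | y ∈ p.support} ⟨z₂, by simp, hz₂⟩
  obtain rfl : w₂ = w₄.reverse.append w₃.reverse := by
    rw [← Walk.reverse_append, ← hw, Walk.reverse_reverse]
  let q : G.Walk z₁ z₂ := (w₃.reverse.mapLe hT).append (.cons hab' (w₁.mapLe hT))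
  have hql : q.length = w₃.length + w₁.length + 1 := by simp [q]; omega
  have hnd := hp'.edges_nodup
  simp only [Walk.edges_append, Walk.edges_reverse, List.nodup_append', List.nodup_reverse,
    List.disjoint_append_right, List.disjoint_reverse_right] at hnd
  obtain ⟨hn1, ⟨hn4, hn3, -⟩, -, hn13⟩ := hnd
  have hq : q.IsTrail := by
    rw [Walk.isTrail_def]
    simp only [q, Walk.edges_append, Walk.edges_cons, Walk.edges_mapLe_eq_edges, Walk.edges_reverse]
    rw [List.nodup_append']
    refine ⟨by simpa using hn3, List.nodup_cons.mpr ⟨hnp' _, hn1⟩, ?_⟩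
    intro e he he'
    rw [List.mem_reverse] at he
    rcases List.mem_cons.mp he' with rfl | he'
    · exact hnp' _ he
    · exact hn13 he' he
  have key : ∀ e : Sym2 V, (∃ y ∈ e, y ∉ {y | y ∈ p.support}) → e ∉ p.edges := by
    rintro e ⟨y, hy, hyp⟩ he
    exact hyp (p.mem_support_of_mem_edges he hy)
  obtain ⟨d, hd, hd0, hdl, hde⟩ := exists_even_closed_trail_of_ear c hc
    (by rw [hcl]; exact hpe.add_one) ((hcs _).mpr hz₁) ((hcs _).mpr hz₂) q hq (by omega) (by
      intro e he he'
      simp only [q, Walk.edges_append, Walk.edges_cons, Walk.edges_mapLe_eq_edges,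
        Walk.edges_reverse, List.mem_append, List.mem_reverse, List.mem_cons] at he
      rw [hce] at he'
      rcases he with he | rfl | he
      · rcases he' with rfl | he'
        · exact hnp _ he
        · exact key e (hw₃ e he) he'
      · rcases he' with he' | he'
        · exact hne he'.symm
        · exact hnp' _ he'
      · rcases he' with rfl | he'
        · exact hnp _ he
        · exact key e (hw₁ e he) he')
  refine ⟨z₁, d, hd, hd0, ?_, hde⟩
  simp only [Walk.length_append, Walk.length_reverse]
  omega

lemma SimpleGraph.Walk.exists_pair_mem_support {V : Type*} {T : SimpleGraph V} (U : Set V) {a b : V}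
    (hU : a ∈ U ∨ b ∈ U) (hTU : ∀ x y, T.Adj x y → x ∈ U ∨ y ∈ U) (p : T.Walk b a)
    (hp : p.IsPath) (hab : a ≠ b) (hpe : Even p.length) :
    ∃ x ∈ p.support, ∃ y ∈ p.support, x ≠ y ∧ x ∈ U ∧ y ∈ U := by
  wlog ha : a ∈ U generalizing a b
  · obtain ⟨x, hx, y, hy, h⟩ := this hU.symm p.reverse hp.reverse hab.symm (by simpa using hpe)
      (hU.resolve_left ha)
    exact ⟨x, by simpa using hx, y, by simpa using hy, h⟩
  by_cases hb : b ∈ U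
  · exact ⟨a, by simp, b, by simp, hab, ha, hb⟩
  cases p with
  | nil => exact absurd rfl hab
  | @cons _ c _ h p =>
    refine ⟨a, by simp, c, by simp, ?_, ha, (hTU _ _ h).resolve_left hb⟩
    rintro rfl
    have : p = .nil := by
      have := (Walk.cons_isPath_iff h p).mp hp
      exact (Walk.isPath_iff_nil.mp this.1).eq_nil
    subst this
    simp at hpe

/-- `Y` carries a connected subgraph with at most `#Y` edges, all taken from `F`, in which every
vertex is within distance `k` of `v`. -/
def IsSpannedWithin {V : Type*} (F : Finset (Sym2 V)) (v : V) (k : ℕ) (Y : Finset V) : Prop :=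
  ∃ T ⊆ F, T.card ≤ Y.card ∧ (∀ e ∈ T, ∀ x ∈ e, x ∈ Y) ∧
    ∀ y ∈ Y, ∃ w : (fromEdgeSet (T : Set (Sym2 V))).Walk v y, w.length ≤ k

/-- Every closed trail of length at most `L` with edges in `F` is odd and avoids `r`. -/
def ShortClosedTrailsOdd {V : Type*} (F : Finset (Sym2 V)) (r : V) (L : ℕ) : Prop :=
  ∀ (z : V) (c : (fromEdgeSet (F : Set (Sym2 V))).Walk z z), c.IsTrail → 0 < c.length →
    c.length ≤ L → ¬ Even c.length ∧ r ∉ c.support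

lemma ShortClosedTrailsOdd.mono {V : Type*} {F F' : Finset (Sym2 V)} {r : V} {L L' : ℕ}
    (h : ShortClosedTrailsOdd F r L) (hF : F' ⊆ F) (hL : L' ≤ L) :
    ShortClosedTrailsOdd F' r L' := by
  intro z c hc hc0 hcL
  have hle : fromEdgeSet (F' : Set (Sym2 V)) ≤ fromEdgeSet (F : Set (Sym2 V)) :=
    fromEdgeSet_mono (by exact_mod_cast hF)
  have := h z (c.mapLe hle) (hc.mapLe hle) (by simpa using hc0) (by simpa using hcL.trans hL)
  simpa using this

lemma IsSpannedWithin.singleton {V : Type*} (F : Finset (Sym2 V)) (v : V) :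
    IsSpannedWithin F v 0 {v} :=
  ⟨∅, by simp, by simp, by simp, by
    intro y hy
    rw [Finset.mem_singleton] at hy
    subst hy
    exact ⟨.nil, by simp⟩⟩

lemma IsSpannedWithin.le {V : Type*} {F : Finset (Sym2 V)} {v : V} {k k' : ℕ} {Y : Finset V}
    (h : IsSpannedWithin F v k Y) (hk : k ≤ k') : IsSpannedWithin F v k' Y := by
  obtain ⟨T, h1, h2, h3, h4⟩ := h
  exact ⟨T, h1, h2, h3, fun y hy => let ⟨w, hw⟩ := h4 y hy; ⟨w, hw.trans hk⟩⟩

lemma IsSpannedWithin.union {V : Type*} [DecidableEq V] {F : Finset (Sym2 V)} {v : V} {k : ℕ}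
    {Y S : Finset V} (h : IsSpannedWithin F v k Y) (hYS : Disjoint Y S)
    (hS : ∀ y ∈ S, ∃ x ∈ Y, s(x, y) ∈ F) : IsSpannedWithin F v (k + 1) (Y ∪ S) := by
  obtain ⟨T, hTF, hT, hTY, hTw⟩ := h
  choose! par hpar hparF using hS
  have hle : fromEdgeSet (T : Set (Sym2 V)) ≤
      fromEdgeSet ((T ∪ S.image fun y => s(par y, y) : Finset (Sym2 V)) : Set (Sym2 V)) :=
    fromEdgeSet_mono (by exact_mod_cast Finset.subset_union_left)
  refine ⟨T ∪ S.image fun y => s(par y, y), ?_, ?_, ?_, ?_⟩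
  · intro e he
    rcases Finset.mem_union.mp he with he | he
    · exact hTF he
    · obtain ⟨y, hy, rfl⟩ := Finset.mem_image.mp he
      exact hparF y hy
  · rw [Finset.card_union_of_disjoint hYS]
    exact (Finset.card_union_le _ _).trans (Nat.add_le_add hT Finset.card_image_le)
  · intro e he x hx
    rw [Finset.mem_union]
    rcases Finset.mem_union.mp he with he | he
    · exact Or.inl (hTY e he x hx)
    · obtain ⟨y, hy, rfl⟩ := Finset.mem_image.mp he
      rcases Sym2.mem_iff.mp hx with rfl | rfl
      · exact Or.inl (hpar y hy)
      · exact Or.inr hy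
  · intro y hy
    rcases Finset.mem_union.mp hy with hy | hy
    · obtain ⟨w, hw⟩ := hTw y hy
      exact ⟨w.mapLe hle, by rw [Walk.length_mapLe]; omega⟩
    · obtain ⟨w, hw⟩ := hTw _ (hpar y hy)
      refine ⟨(w.mapLe hle).concat ?_, by rw [Walk.length_concat, Walk.length_mapLe]; omega⟩
      rw [fromEdgeSet_adj]
      refine ⟨?_, ?_⟩
      · rw [Finset.mem_coe]
        exact Finset.mem_union_right _ (Finset.mem_image_of_mem _ hy)
      · intro h
        have := hpar y hy
        rw [h] at this
        exact Finset.disjoint_left.mp hYS this hy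

/-- In a part of small radius the edges outside a spanning tree lie on vertex-disjoint odd cycles,
each of which uses two vertices of `U`. -/
lemma IsSpannedWithin.two_mul_card_le {V : Type*} [DecidableEq V] {F : Finset (Sym2 V)} {v r : V}
    {k : ℕ} {Y U : Finset V} (h : IsSpannedWithin F v k Y) (hdiag : ∀ e ∈ F, ¬ e.IsDiag)
    (hFU : ∀ e ∈ F, ∃ x ∈ e, x ∈ U) (hFr : ShortClosedTrailsOdd F r (4 * k + 2)) :
    2 * (F ∩ Y.sym2).card ≤ 2 * Y.card + (Y ∩ U).card := by
  obtain ⟨T, hTF, hT, hTY, hTw⟩ := h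
  set E := F ∩ Y.sym2 with hE
  have hTG : fromEdgeSet (T : Set (Sym2 V)) ≤ fromEdgeSet (F : Set (Sym2 V)) :=
    fromEdgeSet_mono (by exact_mod_cast hTF)
  have hpath : ∀ e : Sym2 V, ∃ (a b : V) (p : (fromEdgeSet (T : Set (Sym2 V))).Walk b a),
      e ∈ E \ T → e = s(a, b) ∧ p.IsPath ∧ p.length ≤ 2 * k := by
    intro e
    induction e with | _ a b
    by_cases he : s(a, b) ∈ E \ T
    swap
    · exact ⟨a, a, .nil, fun h => absurd h he⟩
    simp only [hE, Finset.mem_sdiff, Finset.mem_inter, Finset.mem_sym2_iff] at he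
    obtain ⟨w₁, hw₁⟩ := hTw a (he.1.2 a (by simp))
    obtain ⟨w₂, hw₂⟩ := hTw b (he.1.2 b (by simp))
    refine ⟨a, b, (w₂.reverse.append w₁).bypass, fun _ => ⟨rfl, Walk.bypass_isPath _, ?_⟩⟩
    refine (Walk.length_bypass_le_length _).trans ?_
    simp
    omega
  choose a b p hp using hpath
  have hadj : ∀ e ∈ E \ T, (fromEdgeSet (F : Set (Sym2 V))).Adj (a e) (b e) ∧
      ¬ (fromEdgeSet (T : Set (Sym2 V))).Adj (a e) (b e) := by
    intro e he
    have hab := (hp e he).1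
    simp only [hE, Finset.mem_sdiff, Finset.mem_inter, Finset.mem_sym2_iff] at he
    rw [fromEdgeSet_adj, fromEdgeSet_adj, ← hab]
    refine ⟨⟨he.1.1, fun h => hdiag e he.1.1 ?_⟩, fun h => he.2 h.1⟩
    rw [hab]
    exact h
  have heven : ∀ e ∈ E \ T, Even (p e).length := by
    intro e he
    by_contra hodd
    have := hFr (a e) (.cons (hadj e he).1 ((p e).mapLe hTG)) (by
      rw [Walk.isTrail_cons]
      refine ⟨(hp e he).2.1.isTrail.mapLe hTG, fun h => ?_⟩
      rw [Walk.edges_mapLe_eq_edges] at h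
      exact (hadj e he).2 ((p e).adj_of_mem_edges h)) (by simp) (by
      have := (hp e he).2.2
      simp; omega)
    apply this.1
    simpa [Nat.even_add_one] using hodd
  have hsub : ∀ e ∈ E \ T, ∀ x ∈ (p e).support, x ∈ Y := by
    intro e he x hx
    by_cases hnil : (p e).Nil
    · have := (hadj e he).1.ne'
      exact absurd hnil.eq this
    · obtain ⟨e', he', hxe'⟩ := (Walk.mem_support_iff_exists_mem_edges_of_not_nil hnil).mp hx
      have := (p e).edges_subset_edgeSet he'
      rw [edgeSet_fromEdgeSet] at this
      exact hTY _ this.1 x hxe'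
  let D : Sym2 V → Finset V := fun e => (p e).support.toFinset ∩ U
  have hD2 : ∀ e ∈ E \ T, 2 ≤ (D e).card := by
    intro e he
    have heF : e ∈ F := by
      simp only [hE, Finset.mem_sdiff, Finset.mem_inter, Finset.mem_sym2_iff] at he
      exact he.1.1
    obtain ⟨x, hx, y, hy, hxy, hxU, hyU⟩ := (p e).exists_pair_mem_support (U : Set V)
      (by
        obtain ⟨x, hx, hxU⟩ := hFU e heF
        rw [(hp e he).1] at hx
        rcases Sym2.mem_iff.mp hx with rfl | rfl
        · exact Or.inl hxU
        · exact Or.inr hxU)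
      (by
        intro x y hxy
        rw [fromEdgeSet_adj] at hxy
        obtain ⟨z, hz, hzU⟩ := hFU _ (hTF hxy.1)
        rcases Sym2.mem_iff.mp hz with rfl | rfl
        · exact Or.inl hzU
        · exact Or.inr hzU)
      (hp e he).2.1 (hadj e he).1.ne (heven e he)
    rw [← Finset.card_pair hxy]
    apply Finset.card_le_card
    intro z hz
    simp only [Finset.mem_insert, Finset.mem_singleton] at hz
    simp only [D, Finset.mem_inter, List.mem_toFinset]
    rcases hz with rfl | rfl
    · exact ⟨hx, hxU⟩
    · exact ⟨hy, hyU⟩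
  have hDdisj : ((E \ T : Finset (Sym2 V)) : Set (Sym2 V)).PairwiseDisjoint D := by
    intro e he e' he' hne
    rw [Finset.mem_coe] at he he'
    rw [Function.onFun, Finset.disjoint_left]
    intro x hx hx'
    simp only [D, Finset.mem_inter, List.mem_toFinset] at hx hx'
    obtain ⟨z, d, hd, hd0, hdl, hde⟩ := exists_even_closed_trail_of_meet hTG (hadj e he).1
      (hadj e' he').1 (hadj e he).2 (hadj e' he').2
      (by rw [← (hp e he).1, ← (hp e' he').1]; exact hne) (p e) (hp e he).2.1.isTrail (p e')
      (hp e' he').2.1.isTrail (heven e he) hx.1 hx'.1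
    refine (hFr z d hd hd0 ?_).1 hde
    have h1 := (hp e he).2.2
    have h2 := (hp e' he').2.2
    omega
  have hsum : 2 * (E \ T).card ≤ (Y ∩ U).card := by
    calc 2 * (E \ T).card = ∑ e ∈ E \ T, 2 := by simp [mul_comm]
      _ ≤ ∑ e ∈ E \ T, (D e).card := Finset.sum_le_sum hD2
      _ = ((E \ T).biUnion D).card := (Finset.card_biUnion hDdisj).symm
      _ ≤ (Y ∩ U).card := by
        apply Finset.card_le_card
        intro x hx
        simp only [D, Finset.mem_biUnion, Finset.mem_inter, List.mem_toFinset] at hx ⊢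
        obtain ⟨e, he, hx, hxU⟩ := hx
        exact ⟨hsub e he x hx, hxU⟩
  have : E.card ≤ (E \ T).card + T.card := by
    rw [← Finset.card_sdiff_add_card_inter E T]
    exact Nat.add_le_add_left (Finset.card_le_card Finset.inter_subset_right) _
  omega

/-- Region growing: either some connected part `X` of small radius has few outer neighbours `S`, or
the balls around `v` grow exponentially. -/
lemma exists_small_boundary_or_growth {V : Type*} [DecidableEq V] {F : Finset (Sym2 V)}
    {W U : Finset V} {v : V} (hv : v ∈ W ∩ U) (hFW : ∀ e ∈ F, ∀ x ∈ e, x ∈ W)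
    (hFU : ∀ e ∈ F, ∃ x ∈ e, x ∈ U) (K j : ℕ) :
    (∃ X S : Finset V, v ∈ X ∧ Disjoint X S ∧ S ⊆ U ∧ X ∪ S ⊆ W ∧
      IsSpannedWithin F v (2 * j) (X ∪ S) ∧
      (∀ e ∈ F, (∃ x ∈ e, x ∈ X) → ∀ x ∈ e, x ∈ X ∪ S) ∧ K * S.card ≤ (X ∩ U).card) ∨
    (∃ B ⊆ W, v ∈ B ∧ IsSpannedWithin F v (2 * j) B ∧
      (K + 1) ^ j ≤ K ^ j * (B ∩ U).card) := by
  rw [Finset.mem_inter] at hv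
  induction j with
  | zero =>
    refine Or.inr ⟨{v}, by simpa using hv.1, by simp, IsSpannedWithin.singleton F v, ?_⟩
    rw [Finset.singleton_inter_of_mem hv.2]
    simp
  | succ j ih =>
    rcases ih with ⟨X, S, h1, h2, h3, h4, h5, h6⟩ | ⟨B, hBW, hvB, hB, hcard⟩
    · exact Or.inl ⟨X, S, h1, h2, h3, h4, h5.le (by omega), h6⟩
    set N := W.filter fun y => y ∉ B ∧ y ∉ U ∧ ∃ x ∈ B, s(x, y) ∈ F with hN
    set X := B ∪ N with hX
    set S := W.filter fun y => y ∉ X ∧ ∃ x ∈ X, s(x, y) ∈ F with hS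
    have hBN : Disjoint B N := Finset.disjoint_left.mpr fun y hy hy' =>
      (Finset.mem_filter.mp hy').2.1 hy
    have hXS : Disjoint X S := Finset.disjoint_left.mpr fun y hy hy' =>
      (Finset.mem_filter.mp hy').2.1 hy
    have hSU : S ⊆ U := by
      intro y hy
      obtain ⟨hyW, hyX, x, hx, hxy⟩ := Finset.mem_filter.mp hy
      by_contra hyU
      have hxU : x ∈ U := by
        obtain ⟨z, hz, hzU⟩ := hFU _ hxy
        rcases Sym2.mem_iff.mp hz with rfl | rfl
        · exact hzU
        · exact absurd hzU hyU
      rcases Finset.mem_union.mp hx with hx | hx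
      · exact hyX (Finset.mem_union_right _ (Finset.mem_filter.mpr
          ⟨hyW, fun h => hyX (Finset.mem_union_left _ h), hyU, x, hx, hxy⟩))
      · exact (Finset.mem_filter.mp hx).2.2.1 hxU
    have hXW : X ∪ S ⊆ W := Finset.union_subset
      (Finset.union_subset hBW (Finset.filter_subset _ _)) (Finset.filter_subset _ _)
    have hspan : IsSpannedWithin F v (2 * (j + 1)) (X ∪ S) :=
      (hB.union hBN fun y hy => (Finset.mem_filter.mp hy).2.2.2).union hXS fun y hy =>
        (Finset.mem_filter.mp hy).2.2
    have hvX : v ∈ X := Finset.mem_union_left _ hvB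
    have hXU : X ∩ U = B ∩ U := by
      ext y
      simp only [hX, hN, Finset.mem_inter, Finset.mem_union, Finset.mem_filter]
      tauto
    rcases le_or_gt (K * S.card) (X ∩ U).card with hle | hlt
    · refine Or.inl ⟨X, S, hvX, hXS, hSU, hXW, hspan, ?_, hle⟩
      intro e he ⟨x, hxe, hx⟩ y hye
      by_cases hyX : y ∈ X
      · exact Finset.mem_union_left _ hyX
      · refine Finset.mem_union_right _ (Finset.mem_filter.mpr ⟨hFW e he y hye, hyX, x, hx, ?_⟩)
        rwa [← (Sym2.mem_and_mem_iff fun h : x = y => hyX (h ▸ hx)).mp ⟨hxe, hye⟩]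
    · refine Or.inr ⟨X ∪ S, hXW, Finset.mem_union_left _ hvX, hspan, ?_⟩
      have : ((X ∪ S) ∩ U).card = (B ∩ U).card + S.card := by
        rw [Finset.union_inter_distrib_right, Finset.inter_eq_left.mpr hSU, hXU,
          Finset.card_union_of_disjoint]
        rw [← hXU]
        exact hXS.mono_left Finset.inter_subset_left
      rw [this]
      rw [hXU] at hlt
      calc (K + 1) ^ (j + 1) = (K + 1) ^ j * (K + 1) := pow_succ _ _
        _ ≤ K ^ j * (B ∩ U).card * (K + 1) := Nat.mul_le_mul_right _ hcard
        _ = K ^ j * ((B ∩ U).card * K + (B ∩ U).card) := by ring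
        _ ≤ K ^ j * ((B ∩ U).card * K + K * S.card) := by gcongr
        _ = K ^ (j + 1) * ((B ∩ U).card + S.card) := by ring

lemma two_mul_pow_le_succ_pow {K : ℕ} (hK : 0 < K) : 2 * K ^ K ≤ (K + 1) ^ K := by
  obtain ⟨k, rfl⟩ := Nat.exists_eq_succ_of_ne_zero hK.ne'
  have h := one_add_mul_le_pow (a := (1 / ((k + 1 : ℕ) : ℝ))) (by
    have : (0 : ℝ) ≤ 1 / ((k + 1 : ℕ) : ℝ) := by positivity
    linarith) (k + 1)
  have hk : (0 : ℝ) < ((k + 1 : ℕ) : ℝ) := by positivity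
  have h2 : (2 : ℝ) ≤ (1 + 1 / ((k + 1 : ℕ) : ℝ)) ^ (k + 1) := by
    refine le_trans (le_of_eq ?_) h
    field_simp
    norm_num
  have h3 := mul_le_mul_of_nonneg_right h2 (pow_nonneg hk.le (k + 1))
  rw [← mul_pow, add_mul, one_div, inv_mul_cancel₀ hk.ne', one_mul] at h3
  exact_mod_cast h3

lemma exists_small_boundary {V : Type*} [DecidableEq V] {F : Finset (Sym2 V)}
    {W U : Finset V} {v : V} (hv : v ∈ W ∩ U) (hFW : ∀ e ∈ F, ∀ x ∈ e, x ∈ W)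
    (hFU : ∀ e ∈ F, ∃ x ∈ e, x ∈ U) {K m : ℕ} (hK : 0 < K) (hm : U.card < 2 ^ m) :
    ∃ X S : Finset V, v ∈ X ∧ Disjoint X S ∧ S ⊆ U ∧ X ∪ S ⊆ W ∧
      IsSpannedWithin F v (2 * (K * m)) (X ∪ S) ∧
      (∀ e ∈ F, (∃ x ∈ e, x ∈ X) → ∀ x ∈ e, x ∈ X ∪ S) ∧ K * S.card ≤ (X ∩ U).card := by
  rcases exists_small_boundary_or_growth hv hFW hFU K (K * m) with h | ⟨B, -, -, -, hB⟩
  · exact h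
  · exfalso
    have h1 : 2 ^ m * K ^ (K * m) ≤ (K + 1) ^ (K * m) := by
      rw [pow_mul, pow_mul, ← mul_pow]
      exact Nat.pow_le_pow_left (two_mul_pow_le_succ_pow hK) m
    have h2 : (B ∩ U).card < 2 ^ m :=
      (Finset.card_le_card Finset.inter_subset_right).trans_lt hm
    have h3 : 0 < K ^ (K * m) := by positivity
    have := (Nat.mul_lt_mul_of_pos_right h2 h3)
    rw [mul_comm] at this
    omega

/-- A graph in which `U` covers all edges and all short closed trails are odd and avoid `r` has at
most `#W + #U / 2` edges, up to a small error. -/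
theorem card_edges_le_of_shortClosedTrailsOdd {V : Type*} [DecidableEq V] {U : Finset V} {r : V}
    {K m : ℕ} (hK : 0 < K) (hm : U.card < 2 ^ m) (F : Finset (Sym2 V)) (W : Finset V)
    (hdiag : ∀ e ∈ F, ¬ e.IsDiag) (hFW : ∀ e ∈ F, ∀ x ∈ e, x ∈ W)
    (hFU : ∀ e ∈ F, ∃ x ∈ e, x ∈ U) (hFr : ShortClosedTrailsOdd F r (8 * (K * m) + 2)) :
    2 * K * F.card ≤ 2 * K * W.card + (K + 3) * (W ∩ U).card := by
  induction hn : W.card using Nat.strong_induction_on generalizing F W with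
  | _ n ih =>
  subst hn
  rcases (W ∩ U).eq_empty_or_nonempty with hWU | ⟨v, hv⟩
  · have : F = ∅ := by
      rw [Finset.eq_empty_iff_forall_notMem]
      intro e he
      obtain ⟨x, hx, hxU⟩ := hFU e he
      have : x ∈ W ∩ U := Finset.mem_inter.mpr ⟨hFW e he x hx, hxU⟩
      simp [hWU] at this
    simp [this]
  obtain ⟨X, S, hvX, hXS, hSU, hXSW, hspan, hcl, hcard⟩ :=
    exists_small_boundary hv hFW hFU hK hm
  have hXW : X ⊆ W := Finset.subset_union_left.trans hXSW
  set F' := F ∩ (W \ X).sym2 with hF'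
  have hF'F : F' ⊆ F := Finset.inter_subset_left
  have hrest := ih (W \ X).card
    (Finset.card_lt_card (Finset.sdiff_ssubset hXW ⟨v, hvX⟩)) F' (W \ X)
    (fun e he => hdiag e (hF'F he))
    (fun e he => Finset.mem_sym2_iff.mp (Finset.mem_inter.mp he).2)
    (fun e he => hFU e (hF'F he)) (hFr.mono hF'F le_rfl) rfl
  have hpart := hspan.two_mul_card_le hdiag hFU (hFr.mono subset_rfl (by omega))
  have hF : F.card ≤ F'.card + (F ∩ (X ∪ S).sym2).card := by
    refine (Finset.card_le_card ?_).trans (Finset.card_union_le _ _)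
    intro e he
    by_cases h : ∃ x ∈ e, x ∈ X
    · exact Finset.mem_union_right _ (Finset.mem_inter.mpr
        ⟨he, Finset.mem_sym2_iff.mpr (hcl e he h)⟩)
    · push Not at h
      exact Finset.mem_union_left _ (Finset.mem_inter.mpr ⟨he, Finset.mem_sym2_iff.mpr
        fun x hx => Finset.mem_sdiff.mpr ⟨hFW e he x hx, h x hx⟩⟩)
  have hW : (W \ X).card + X.card = W.card := Finset.card_sdiff_add_card_eq_card hXW
  have hWU : ((W \ X) ∩ U).card + (X ∩ U).card = (W ∩ U).card := by
    rw [← Finset.card_union_of_disjoint]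
    · rw [← Finset.union_inter_distrib_right, Finset.sdiff_union_of_subset hXW]
    · exact Finset.sdiff_disjoint.mono Finset.inter_subset_left Finset.inter_subset_left
  rw [Finset.card_union_of_disjoint hXS, Finset.union_inter_distrib_right] at hpart
  have hXSU : (X ∩ U ∪ S ∩ U).card ≤ (X ∩ U).card + S.card :=
    (Finset.card_union_le _ _).trans
      (Nat.add_le_add_left (Finset.card_le_card Finset.inter_subset_left) _)
  rw [← hW, ← hWU]
  have h1 : K * (2 * (F ∩ (X ∪ S).sym2).card) ≤
      K * (2 * (X.card + S.card) + ((X ∩ U).card + S.card)) :=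
    Nat.mul_le_mul_left _ (hpart.trans (by omega))
  have h2 := Nat.mul_le_mul_left (2 * K) hF
  nlinarith

lemma SimpleGraph.Walk.IsTrail.exists_alternating_sign {V : Type*} [DecidableEq V]
    {G : SimpleGraph V} :
    ∀ {u x : V} (w : G.Walk u x), w.IsTrail → ∃ σ : Sym2 V → ℤ, (∀ e, σ e = 1 ∨ σ e = -1) ∧
      ∀ y, (w.edges.map fun e => if y ∈ e then σ e else 0).sum =
        (if y = u then 1 else 0) - (-1) ^ w.length * (if y = x then 1 else 0)
  | u, _, .nil, _ => ⟨fun _ => 1, fun _ => Or.inl rfl, fun y => by simp⟩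
  | u, x, .cons (v := v) h p, hw => by
    rw [Walk.isTrail_cons] at hw
    obtain ⟨σ, hσ, hsum⟩ := exists_alternating_sign p hw.1
    refine ⟨fun e => if e = s(u, v) then 1 else -σ e, fun e => ?_, fun y => ?_⟩
    · beta_reduce
      split_ifs
      · exact Or.inl rfl
      · rcases hσ e with h | h <;> simp [h]
    · have h1 : (p.edges.map fun e => if y ∈ e then (if e = s(u, v) then 1 else -σ e) else 0) =
          p.edges.map fun e => (-1) * (if y ∈ e then σ e else 0) := by
        apply List.map_congr_left
        intro e he
        have : e ≠ s(u, v) := fun h => hw.2 (h ▸ he)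
        simp [this]
      rw [Walk.edges_cons, List.map_cons, List.sum_cons, h1, List.sum_map_mul_left, hsum,
        Walk.length_cons, pow_succ]
      have huv : u ≠ v := h.ne
      by_cases hyu : y = u
      · subst hyu
        simp only [Sym2.mem_iff, true_or, if_true, huv, if_false]
        ring
      · by_cases hyv : y = v
        · subst hyv
          simp only [Sym2.mem_iff, or_true, if_true, hyu, if_false]
          ring
        · simp [hyu, hyv]

lemma SimpleGraph.Walk.IsTrail.exists_balanced_sign {V : Type*} [DecidableEq V]
    {G : SimpleGraph V} {z r : V} {c : G.Walk z z} (hc : c.IsTrail)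
    (hr : Even c.length ∨ r ∈ c.support) :
    ∃ σ : Sym2 V → ℤ, (∀ e, σ e = 1 ∨ σ e = -1) ∧
      ∀ y, y ≠ r → ∑ e ∈ c.edges.toFinset, (if y ∈ e then σ e else 0) = 0 := by
  rcases hr with hev | hr
  · obtain ⟨σ, hσ, hsum⟩ := exists_alternating_sign c hc
    refine ⟨σ, hσ, fun y _ => ?_⟩
    rw [List.sum_toFinset _ hc.edges_nodup, hsum, hev.neg_one_pow]
    ring
  · obtain ⟨σ, hσ, hsum⟩ := exists_alternating_sign (c.rotate r hr) (hc.rotate hr)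
    refine ⟨σ, hσ, fun y hy => ?_⟩
    have hset : c.edges.toFinset = (c.rotate r hr).edges.toFinset :=
      (List.toFinset_eq_of_perm _ _ (c.rotate_edges r hr).perm).symm
    rw [hset, List.sum_toFinset _ (hc.rotate hr).edges_nodup, hsum]
    simp [hy]

/-- Disjoint, not both empty finite sets whose products agree at all primes satisfying `P`. -/
structure IsBalancedPair (P : ℕ → Prop) (B C : Finset ℕ) : Prop where
  disjoint : Disjoint B C
  nonempty : (B ∪ C).Nonempty
  sum_eq : ∀ p : ℕ, p.Prime → P p →
    ∑ b ∈ B, b.factorization p = ∑ c ∈ C, c.factorization p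

lemma exists_isBalancedPair_of_closed_trail {P : ℕ → Prop} {A : Finset ℕ} {ed : ℕ → Sym2 ℕ} {r : ℕ}
    (hinj : Set.InjOn ed A) (hr : ¬ (r.Prime ∧ P r))
    (hfac : ∀ a ∈ A, ∀ p : ℕ, p.Prime → P p → a.factorization p = if p ∈ ed a then 1 else 0)
    {z : ℕ} (c : (fromEdgeSet (A.image ed : Set (Sym2 ℕ))).Walk z z) (hc : c.IsTrail)
    (hc0 : 0 < c.length) (hcr : Even c.length ∨ r ∈ c.support) :
    ∃ B C : Finset ℕ, IsBalancedPair P B C ∧ B ∪ C ⊆ A ∧ (B ∪ C).card ≤ c.length := by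
  obtain ⟨σ, hσ, hsum⟩ := hc.exists_balanced_sign hcr
  set A₀ := A.filter fun a => ed a ∈ c.edges with hA₀
  have hA₀A : A₀ ⊆ A := Finset.filter_subset _ _
  have hinj₀ : Set.InjOn ed A₀ := hinj.mono (by exact_mod_cast hA₀A)
  have himg : A₀.image ed = c.edges.toFinset := by
    ext e
    simp only [hA₀, Finset.mem_image, Finset.mem_filter, List.mem_toFinset]
    constructor
    · rintro ⟨a, ⟨-, ha⟩, rfl⟩
      exact ha
    · intro he
      have h := c.edges_subset_edgeSet he
      rw [edgeSet_fromEdgeSet] at h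
      obtain ⟨a, ha, rfl⟩ := Finset.mem_image.mp (Finset.mem_coe.mp h.1)
      exact ⟨a, ⟨ha, he⟩, rfl⟩
  have hcard : A₀.card = c.length := by
    rw [← Finset.card_image_of_injOn hinj₀, himg, List.toFinset_card_of_nodup hc.edges_nodup,
      Walk.length_edges]
  have hne : ∀ a, ¬ σ (ed a) = 1 ↔ σ (ed a) = -1 := fun a => by
    rcases hσ (ed a) with h | h <;> simp [h]
  have hun : (A₀.filter fun a => σ (ed a) = 1) ∪ (A₀.filter fun a => ¬ σ (ed a) = 1) = A₀ :=
    Finset.filter_union_filter_not_eq _ _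
  refine ⟨A₀.filter fun a => σ (ed a) = 1, A₀.filter fun a => ¬ σ (ed a) = 1, ⟨?_, ?_, ?_⟩, ?_, ?_⟩
  · exact Finset.disjoint_filter_filter_not _ _ _
  · rw [hun, ← Finset.card_pos, hcard]
    exact hc0
  · intro p hp hPp
    have hpr : p ≠ r := fun h => hr (h ▸ ⟨hp, hPp⟩)
    have h := hsum p hpr
    rw [← himg, Finset.sum_image hinj₀, ← Finset.sum_filter_add_sum_filter_not A₀
      (fun a => σ (ed a) = 1)] at h
    have h1 : ∑ a ∈ A₀ with σ (ed a) = 1, (if p ∈ ed a then σ (ed a) else 0) =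
        ((∑ a ∈ A₀ with σ (ed a) = 1, a.factorization p : ℕ) : ℤ) := by
      rw [Nat.cast_sum]
      refine Finset.sum_congr rfl fun a ha => ?_
      rw [Finset.mem_filter] at ha
      rw [hfac a (hA₀A ha.1) p hp hPp, ha.2]
      simp
    have h2 : ∑ a ∈ A₀ with ¬ σ (ed a) = 1, (if p ∈ ed a then σ (ed a) else 0) =
        -((∑ a ∈ A₀ with ¬ σ (ed a) = 1, a.factorization p : ℕ) : ℤ) := by
      rw [Nat.cast_sum, ← Finset.sum_neg_distrib]
      refine Finset.sum_congr rfl fun a ha => ?_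
      rw [Finset.mem_filter, hne] at ha
      rw [hfac a (hA₀A ha.1) p hp hPp, ha.2]
      split_ifs <;> simp
    rw [h1, h2] at h
    omega
  · rw [hun]
    exact hA₀A
  · rw [hun, hcard]

lemma exists_maximal_disjoint_balancedPairs (P : ℕ → Prop) (L : ℕ) (A : Finset ℕ) :
    ∃ 𝒯 : Finset (Finset ℕ × Finset ℕ),
      (∀ t ∈ 𝒯, IsBalancedPair P t.1 t.2 ∧ t.1 ∪ t.2 ⊆ A ∧ (t.1 ∪ t.2).card ≤ L) ∧
      (𝒯 : Set (Finset ℕ × Finset ℕ)).PairwiseDisjoint (fun t => t.1 ∪ t.2) ∧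
      ∀ B C : Finset ℕ, IsBalancedPair P B C → B ∪ C ⊆ A \ 𝒯.biUnion (fun t => t.1 ∪ t.2) →
        L < (B ∪ C).card := by
  induction hn : A.card using Nat.strong_induction_on generalizing A with
  | _ n ih =>
  subst hn
  by_cases h : ∃ B C : Finset ℕ, IsBalancedPair P B C ∧ B ∪ C ⊆ A ∧ (B ∪ C).card ≤ L
  · obtain ⟨B, C, hBC, hBCA, hL⟩ := h
    obtain ⟨𝒯, h1, h2, h3⟩ := ih (A \ (B ∪ C)).card
      (Finset.card_lt_card (Finset.sdiff_ssubset hBCA hBC.nonempty)) (A \ (B ∪ C)) rfl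
    refine ⟨insert (B, C) 𝒯, ?_, ?_, ?_⟩
    · intro t ht
      rcases Finset.mem_insert.mp ht with rfl | ht
      · exact ⟨hBC, hBCA, hL⟩
      · exact ⟨(h1 t ht).1, (h1 t ht).2.1.trans Finset.sdiff_subset, (h1 t ht).2.2⟩
    · rw [Finset.coe_insert, Set.pairwiseDisjoint_insert]
      refine ⟨h2, fun t ht _ => ?_⟩
      exact Finset.disjoint_sdiff.mono_right (h1 t ht).2.1
    · intro B' C' hBC' hsub
      refine h3 B' C' hBC' ?_
      rw [Finset.biUnion_insert] at hsub
      rwa [sdiff_sdiff_left]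
  · push Not at h
    exact ⟨∅, by simp, by simp, fun B C hBC hsub => h B C hBC (by simpa using hsub)⟩

/-- Pigeonhole: disjoint balanced pairs inside a set with distinct subset products are few. -/
lemma two_pow_card_le_of_balancedPairs {P : ℕ → Prop} {A Q : Finset ℕ}
    (hA : DistinctSubsetProds A) (hsq : ∀ a ∈ A, Squarefree a)
    (hQ : ∀ q : ℕ, q.Prime → ¬ P q → q ∈ Q) {𝒯 : Finset (Finset ℕ × Finset ℕ)}
    (h𝒯 : ∀ t ∈ 𝒯, IsBalancedPair P t.1 t.2 ∧ t.1 ∪ t.2 ⊆ A)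
    (hdisj : (𝒯 : Set (Finset ℕ × Finset ℕ)).PairwiseDisjoint (fun t => t.1 ∪ t.2)) :
    2 ^ 𝒯.card ≤ (A.card + 1) ^ Q.card := by
  classical
  let pick : Finset (Finset ℕ × Finset ℕ) → Finset ℕ × Finset ℕ → Finset ℕ :=
    fun J t => if t ∈ J then t.1 else t.2
  let D : Finset (Finset ℕ × Finset ℕ) → Finset ℕ := fun J => 𝒯.biUnion (pick J)
  have hpick : ∀ J t, pick J t ⊆ t.1 ∪ t.2 := by
    intro J t
    simp only [pick]
    split_ifs
    · exact Finset.subset_union_left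
    · exact Finset.subset_union_right
  have hDA : ∀ J, D J ⊆ A := fun J =>
    Finset.biUnion_subset.mpr fun t ht => (hpick J t).trans (h𝒯 t ht).2
  have hDsum : ∀ J (f : ℕ → ℕ), ∑ a ∈ D J, f a = ∑ t ∈ 𝒯, ∑ a ∈ pick J t, f a := fun J f =>
    Finset.sum_biUnion fun t ht t' ht' hne =>
      (hdisj ht ht' hne).mono (hpick J t) (hpick J t')
  have hDmem : ∀ J, ∀ t ∈ 𝒯, ∀ x ∈ t.1 ∪ t.2, x ∈ D J ↔ x ∈ pick J t := by
    intro J t ht x hx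
    constructor
    · intro h
      obtain ⟨t', ht', hx'⟩ := Finset.mem_biUnion.mp h
      obtain rfl : t = t' := by
        by_contra hne
        exact Finset.disjoint_left.mp (hdisj ht ht' hne) hx (hpick J t' hx')
      exact hx'
    · exact fun h => Finset.mem_biUnion.mpr ⟨t, ht, h⟩
  have hDinj : ∀ J ⊆ 𝒯, ∀ J', D J = D J' → J ⊆ J' := by
    intro J hJ J' hJJ' t htJ
    by_contra htJ'
    have ht := hJ htJ
    obtain ⟨x, hx⟩ := (h𝒯 t ht).1.nonempty
    have h1 := hDmem J t ht x hx
    have h2 := hDmem J' t ht x hx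
    simp only [pick, htJ, htJ', if_true, if_false] at h1 h2
    rw [hJJ', h2] at h1
    have : x ∈ t.1 → x ∉ t.2 := fun h => Finset.disjoint_left.mp (h𝒯 t ht).1.disjoint h
    rw [Finset.mem_union] at hx
    tauto
  have hA0 : ∀ a ∈ A, a ≠ 0 := fun a ha => (hsq a ha).ne_zero
  let Φ : Finset (Finset ℕ × Finset ℕ) → Q → ℕ := fun J q => ∑ a ∈ D J, a.factorization q
  have hΦ : Set.InjOn Φ (𝒯.powerset : Set (Finset (Finset ℕ × Finset ℕ))) := by
    intro J hJ J' hJ' h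
    rw [Finset.mem_coe, Finset.mem_powerset] at hJ hJ'
    have hprod : ∏ a ∈ D J, a = ∏ a ∈ D J', a := by
      refine Nat.eq_of_factorization_eq
        (Finset.prod_ne_zero_iff.mpr fun a ha => hA0 a (hDA J ha))
        (Finset.prod_ne_zero_iff.mpr fun a ha => hA0 a (hDA J' ha)) fun p => ?_
      rw [Nat.factorization_prod fun a ha => hA0 a (hDA J ha),
        Nat.factorization_prod fun a ha => hA0 a (hDA J' ha), Finsupp.finsetSum_apply,
        Finsupp.finsetSum_apply]
      by_cases hp : p.Prime
      · by_cases hPp : P p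
        · rw [hDsum, hDsum]
          refine Finset.sum_congr rfl fun t ht => ?_
          have := (h𝒯 t ht).1.sum_eq p hp hPp
          simp only [pick]
          split_ifs <;> simp [this]
        · exact congrFun h ⟨p, hQ p hp hPp⟩
      · simp [Nat.factorization_eq_zero_of_not_prime, hp]
    have hD : D J = D J' := hA _ _ (by exact_mod_cast hDA J) (by exact_mod_cast hDA J') hprod
    exact (hDinj J hJ J' hD).antisymm (hDinj J' hJ' J hD.symm)
  have hmaps : ∀ J ∈ 𝒯.powerset, Φ J ∈ Fintype.piFinset fun _ : Q => Finset.range (A.card + 1) := by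
    intro J _
    rw [Fintype.mem_piFinset]
    intro q
    rw [Finset.mem_range, Nat.lt_succ_iff]
    calc ∑ a ∈ D J, a.factorization q ≤ ∑ a ∈ D J, 1 :=
          Finset.sum_le_sum fun a ha => (hsq a (hDA J ha)).natFactorization_le_one q
      _ = (D J).card := by simp
      _ ≤ A.card := Finset.card_le_card (hDA J)
  have := Finset.card_le_card_of_injOn Φ hmaps hΦ
  simpa using this

lemma card_primeFactors_filter_le_two {N a : ℕ} (ha : a ≠ 0) (haN : a ≤ N) :
    (a.primeFactors.filter fun p => N < p ^ 3).card ≤ 2 := by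
  by_contra! h
  obtain ⟨p, q, s, hp, hq, hs, hpq, hps, hqs⟩ := Finset.two_lt_card_iff.mp h
  simp only [Finset.mem_filter, Nat.mem_primeFactors] at hp hq hs
  have h1 : p.Coprime q := (Nat.coprime_primes hp.1.1 hq.1.1).mpr hpq
  have h2 : (p * q).Coprime s := Nat.Coprime.mul_left
    ((Nat.coprime_primes hp.1.1 hs.1.1).mpr hps) ((Nat.coprime_primes hq.1.1 hs.1.1).mpr hqs)
  have h3 : p * q * s ∣ a :=
    h2.mul_dvd_of_dvd_of_dvd (h1.mul_dvd_of_dvd_of_dvd hp.1.2.1 hq.1.2.1) hs.1.2.1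
  have h4 : p * q * s ≤ N := (Nat.le_of_dvd (Nat.pos_of_ne_zero ha) h3).trans haN
  have h5 : N * N * N < p ^ 3 * q ^ 3 * s ^ 3 :=
    Nat.mul_lt_mul'' (Nat.mul_lt_mul'' hp.2 hq.2) hs.2
  have h6 : (p * q * s) ^ 3 ≤ N ^ 3 := Nat.pow_le_pow_left h4 3
  have h7 : p ^ 3 * q ^ 3 * s ^ 3 = (p * q * s) ^ 3 := by ring
  have h8 : N * N * N = N ^ 3 := by ring
  omega

/-- A squarefree `a ≤ N` has at most two prime factors above `N ^ (1 / 3)`; they are recorded as an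
unordered pair, padded with `1`. -/
lemma exists_large_part {N a : ℕ} (hsq : Squarefree a) (haN : a ≤ N) :
    ∃ u v : ℕ, (u = 1 ∨ u.Prime) ∧ (v = 1 ∨ v.Prime) ∧ (u = v → u = 1) ∧ u * v ≤ N ∧
      ∀ p : ℕ, p.Prime → N < p ^ 3 → a.factorization p = if p ∈ s(u, v) then 1 else 0 := by
  set S := a.primeFactors.filter fun p => N < p ^ 3 with hS
  have hfac : ∀ p : ℕ, p.Prime → N < p ^ 3 → a.factorization p = if p ∈ S then 1 else 0 := by
    intro p hp hpN
    have h1 := hsq.natFactorization_le_one p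
    have h2 : p ∈ S ↔ a.factorization p ≠ 0 := by
      rw [← Finsupp.mem_support_iff, Nat.support_factorization, hS, Finset.mem_filter]
      simp [hpN]
    simp only [h2]
    split_ifs with h <;> omega
  have hpos : 0 < a := Nat.pos_of_ne_zero hsq.ne_zero
  have hSp : ∀ p ∈ S, p.Prime ∧ p ∣ a := fun p hp =>
    ⟨Nat.prime_of_mem_primeFactors (Finset.mem_filter.mp hp).1,
      Nat.dvd_of_mem_primeFactors (Finset.mem_filter.mp hp).1⟩
  have hcard : S.card ≤ 2 := card_primeFactors_filter_le_two hsq.ne_zero haN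
  have hcases : S.card = 0 ∨ S.card = 1 ∨ S.card = 2 := by omega
  rcases hcases with h | h | h
  · rw [Finset.card_eq_zero] at h
    refine ⟨1, 1, Or.inl rfl, Or.inl rfl, fun _ => rfl, by omega, fun p hp hpN => ?_⟩
    rw [hfac p hp hpN, h]
    simp [hp.ne_one]
  · obtain ⟨q, hq⟩ := Finset.card_eq_one.mp h
    have hqS := hSp q (by simp [hq])
    refine ⟨1, q, Or.inl rfl, Or.inr hqS.1, fun _ => rfl, ?_, fun p hp hpN => ?_⟩
    · rw [one_mul]
      exact (Nat.le_of_dvd hpos hqS.2).trans haN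
    · rw [hfac p hp hpN, hq]
      simp [hp.ne_one]
  · obtain ⟨q, s, hqs, hq⟩ := Finset.card_eq_two.mp h
    have hqS := hSp q (by simp [hq])
    have hsS := hSp s (by simp [hq])
    refine ⟨q, s, Or.inr hqS.1, Or.inr hsS.1, fun h => absurd h hqs, ?_, fun p hp hpN => ?_⟩
    · exact (Nat.le_of_dvd hpos (((Nat.coprime_primes hqS.1 hsS.1).mpr hqs).mul_dvd_of_dvd_of_dvd
        hqS.2 hsS.2)).trans haN
    · rw [hfac p hp hpN, hq]
      simp

lemma two_mul_card_le_of_no_short_balancedPair {N K m : ℕ} {A : Finset ℕ} (hK : 0 < K) (hN : 0 < N)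
    (hm : N < 2 ^ m) (hAN : ∀ a ∈ A, a ≤ N) (hsq : ∀ a ∈ A, Squarefree a)
    (hno : ∀ B C : Finset ℕ, IsBalancedPair (fun p => N < p ^ 3) B C → B ∪ C ⊆ A →
      8 * (K * m) + 2 < (B ∪ C).card) :
    2 * K * A.card ≤ 2 * K * (((Finset.Icc 1 N).filter Nat.Prime).card + 1) +
      (K + 3) * (((Finset.Icc 1 N).filter fun p => p.Prime ∧ p ^ 2 ≤ N).card + 1) := by
  choose! u v hu hv huv hle hfac using fun a (ha : a ∈ A) => exists_large_part (hsq a ha) (hAN a ha)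
  let ed : ℕ → Sym2 ℕ := fun a => s(u a, v a)
  have hinj : Set.InjOn ed A := by
    intro a ha b hb hab
    by_contra hne
    have h1 := hno {a} {b} ⟨by simpa using hne, by simp, fun p hp hpN => by
      simp only [ed] at hab
      simp [hfac a ha p hp hpN, hfac b hb p hp hpN, hab]⟩ (by
        intro x hx
        simp only [Finset.mem_union, Finset.mem_singleton] at hx
        rcases hx with rfl | rfl
        · exact ha
        · exact hb)
    have h2 := Finset.card_union_le {a} {b}
    simp only [Finset.card_singleton] at h2
    omega
  set W := insert 1 ((Finset.Icc 1 N).filter Nat.Prime) with hW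
  set U := insert 1 ((Finset.Icc 1 N).filter fun p => p.Prime ∧ p ^ 2 ≤ N) with hU
  have hmemW : ∀ x y, (x = 1 ∨ x.Prime) → (y = 1 ∨ y.Prime) → x * y ≤ N → x ∈ W := by
    intro x y hx hy hxy
    rcases hx with rfl | hx
    · simp [hW]
    · have hy1 : 1 ≤ y := by
        rcases hy with rfl | hy
        · exact le_rfl
        · exact hy.one_lt.le
      have : x ≤ N := by nlinarith
      simp only [hW, Finset.mem_insert, Finset.mem_filter, Finset.mem_Icc]
      exact Or.inr ⟨⟨hx.one_lt.le, this⟩, hx⟩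
  have hbound := card_edges_le_of_shortClosedTrailsOdd (U := U) (r := 1) (m := m) hK (by
      have : U ⊆ Finset.Icc 1 N := by
        intro x hx
        simp only [hU, Finset.mem_insert, Finset.mem_filter] at hx
        rcases hx with rfl | hx
        · simp; omega
        · exact hx.1
      have := Finset.card_le_card this
      simp only [Nat.card_Icc] at this
      omega) (A.image ed) W
    (by
      simp only [Finset.forall_mem_image, ed, Sym2.mk_isDiag_iff]
      intro a ha h
      have hu1 := huv a ha h
      have h1 := hno {a} ∅ ⟨by simp, by simp, fun p hp hpN => by
        simp [hfac a ha p hp hpN, ← h, hu1, hp.ne_one]⟩ (by simpa using ha)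
      simp at h1)
    (by
      simp only [Finset.forall_mem_image, ed, Sym2.mem_iff]
      rintro a ha x (rfl | rfl)
      · exact hmemW _ _ (hu a ha) (hv a ha) (hle a ha)
      · exact hmemW _ _ (hv a ha) (hu a ha) (by rw [mul_comm]; exact hle a ha))
    (by
      simp only [Finset.forall_mem_image, ed]
      intro a ha
      have key : ∀ x y, (x = 1 ∨ x.Prime) → x ≤ y → x * y ≤ N → x ∈ U := by
        intro x y hx hxy hle
        simp only [hU, Finset.mem_insert, Finset.mem_filter, Finset.mem_Icc]
        rcases hx with rfl | hx
        · exact Or.inl rfl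
        · have hx1 := hx.one_lt
          exact Or.inr ⟨⟨hx1.le, by nlinarith⟩, hx, by nlinarith⟩
      rcases le_total (u a) (v a) with h | h
      · exact ⟨u a, by simp, key _ _ (hu a ha) h (hle a ha)⟩
      · exact ⟨v a, by simp, key _ _ (hv a ha) h (by rw [mul_comm]; exact hle a ha)⟩)
    (by
      intro z c hc hc0 hcL
      by_contra hcon
      obtain ⟨B, C, hBC, hBCA, hcard⟩ := exists_isBalancedPair_of_closed_trail
        (P := fun p => N < p ^ 3) hinj (r := 1) (fun h => Nat.not_prime_one h.1) hfac c hc hc0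
        (by tauto)
      have := hno B C hBC hBCA
      omega)
  rw [Finset.card_image_of_injOn hinj] at hbound
  refine hbound.trans (Nat.add_le_add (Nat.mul_le_mul_left _ (Finset.card_insert_le _ _))
    (Nat.mul_le_mul_left _ ?_))
  exact (Finset.card_le_card Finset.inter_subset_right).trans (Finset.card_insert_le _ _)

theorem two_mul_card_le_of_distinctSubsetProds {N K m : ℕ} {A : Finset ℕ} (hK : 0 < K) (hN : 0 < N)
    (hm : N < 2 ^ m) (hAN : A ⊆ Finset.Icc 1 N) (hsq : ∀ a ∈ A, Squarefree a)
    (hA : DistinctSubsetProds A) :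
    2 * K * A.card ≤ 2 * K * (((Finset.Icc 1 N).filter Nat.Prime).card + 1) +
      (K + 3) * (((Finset.Icc 1 N).filter fun p => p.Prime ∧ p ^ 2 ≤ N).card + 1) +
      2 * K * (((Finset.Icc 1 N).filter fun p => p.Prime ∧ p ^ 3 ≤ N).card * m *
        (8 * (K * m) + 2)) := by
  obtain ⟨𝒯, h𝒯, hdisj, hmax⟩ :=
    exists_maximal_disjoint_balancedPairs (fun p => N < p ^ 3) (8 * (K * m) + 2) A
  set R := 𝒯.biUnion fun t => t.1 ∪ t.2 with hR
  set Q := (Finset.Icc 1 N).filter fun p => p.Prime ∧ p ^ 3 ≤ N with hQ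
  have hpow := two_pow_card_le_of_balancedPairs (Q := Q) hA hsq (by
    intro q hq hqN
    rw [not_lt] at hqN
    have : q ≤ q ^ 3 := Nat.le_self_pow (by norm_num) q
    rw [hQ, Finset.mem_filter, Finset.mem_Icc]
    exact ⟨⟨hq.one_lt.le, this.trans hqN⟩, hq, hqN⟩)
    (fun t ht => ⟨(h𝒯 t ht).1, (h𝒯 t ht).2.1⟩) hdisj
  have hAcard : A.card ≤ N := by simpa using Finset.card_le_card hAN
  have h𝒯card : 𝒯.card ≤ Q.card * m := by
    have : 2 ^ 𝒯.card ≤ 2 ^ (Q.card * m) := by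
      refine hpow.trans ?_
      rw [mul_comm, pow_mul]
      exact Nat.pow_le_pow_left (by omega) _
    exact (Nat.pow_le_pow_iff_right (by norm_num)).mp this
  have hRcard : R.card ≤ Q.card * m * (8 * (K * m) + 2) :=
    (Finset.card_biUnion_le_card_mul _ _ _ fun t ht => (h𝒯 t ht).2.2).trans
      (Nat.mul_le_mul_right _ h𝒯card)
  have hrest := two_mul_card_le_of_no_short_balancedPair (A := A \ R) hK hN hm
    (fun a ha => (Finset.mem_Icc.mp (hAN (Finset.mem_sdiff.mp ha).1)).2)
    (fun a ha => hsq a (Finset.mem_sdiff.mp ha).1) hmax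
  have hsplit : A.card ≤ (A \ R).card + R.card := by
    rw [← Finset.card_sdiff_add_card_inter A R]
    exact Nat.add_le_add_left (Finset.card_le_card Finset.inter_subset_right) _
  calc 2 * K * A.card ≤ 2 * K * ((A \ R).card + Q.card * m * (8 * (K * m) + 2)) :=
        Nat.mul_le_mul_left _ (hsplit.trans (Nat.add_le_add_left hRcard _))
    _ = 2 * K * (A \ R).card + 2 * K * (Q.card * m * (8 * (K * m) + 2)) := by ring
    _ ≤ _ := Nat.add_le_add_right hrest _

end Walks

lemma primePi_natCast (N : ℕ) : primePi N = ((Finset.Icc 1 N).filter Nat.Prime).card := by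
  rw [primePi, ← Set.ncard_coe_finset]
  congr 1
  ext p
  simp only [Set.mem_ofPred_eq, Nat.cast_le, Finset.coe_filter, Finset.mem_Icc]
  exact ⟨fun h => ⟨⟨h.1.one_lt.le, h.2⟩, h.1⟩, fun h => ⟨h.2, h.1.2⟩⟩

lemma primePi_rpow_half (N : ℕ) : primePi ((N : ℝ) ^ ((1 : ℝ) / 2)) =
    ((Finset.Icc 1 N).filter fun p => p.Prime ∧ p ^ 2 ≤ N).card := by
  rw [primePi, ← Set.ncard_coe_finset]
  congr 1
  ext p
  have h : (p : ℝ) ≤ (N : ℝ) ^ ((1 : ℝ) / 2) ↔ p ^ 2 ≤ N := by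
    rw [← Real.sqrt_eq_rpow, Real.le_sqrt (Nat.cast_nonneg p) (Nat.cast_nonneg N)]
    exact_mod_cast Iff.rfl
  simp only [Set.mem_ofPred_eq, Finset.coe_filter, Finset.mem_Icc, h]
  refine ⟨fun hp => ⟨⟨hp.1.one_lt.le, ?_⟩, hp⟩, fun hp => hp.2⟩
  exact (Nat.le_self_pow (by norm_num) p).trans hp.2

lemma card_filter_prime_pow_le (N k : ℕ) (hk : k ≠ 0) :
    (((Finset.Icc 1 N).filter fun p => p.Prime ∧ p ^ k ≤ N).card : ℝ) ≤
      (N : ℝ) ^ ((1 : ℝ) / k) := by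
  have hsub : ((Finset.Icc 1 N).filter fun p => p.Prime ∧ p ^ k ≤ N) ⊆
      Finset.Icc 1 ⌊(N : ℝ) ^ ((1 : ℝ) / k)⌋₊ := by
    intro p hp
    simp only [Finset.mem_filter, Finset.mem_Icc] at hp ⊢
    refine ⟨hp.1.1, Nat.le_floor ?_⟩
    rw [one_div, Real.le_rpow_inv_iff_of_pos (Nat.cast_nonneg p) (Nat.cast_nonneg N)
      (by positivity), Real.rpow_natCast]
    exact_mod_cast hp.2.2
  have h := Finset.card_le_card hsub
  rw [Nat.card_Icc, Nat.add_sub_cancel] at h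
  exact (Nat.cast_le.mpr h).trans (Nat.floor_le (by positivity))

lemma natLog_two_add_one_le {ε : ℝ} (hε : 0 < ε) {N : ℕ} (hN : 0 < N) :
    ((Nat.log 2 N + 1 : ℕ) : ℝ) ≤ (1 + 1 / (ε * Real.log 2)) * (N : ℝ) ^ ε := by
  have hlog2 : 0 < Real.log 2 := Real.log_pos (by norm_num)
  have h1 : (Nat.log 2 N : ℝ) * Real.log 2 ≤ Real.log N := by
    rw [← Real.log_pow]
    refine Real.log_le_log (by positivity) ?_
    exact_mod_cast Nat.pow_log_le_self 2 hN.ne'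
  have h2 : Real.log N ≤ (N : ℝ) ^ ε / ε := Real.log_le_rpow_div (Nat.cast_nonneg N) hε
  have h3 : (1 : ℝ) ≤ (N : ℝ) ^ ε := Real.one_le_rpow (by exact_mod_cast hN) hε.le
  have h4 : (Nat.log 2 N : ℝ) ≤ (N : ℝ) ^ ε / ε / Real.log 2 :=
    (le_div_iff₀ hlog2).mpr (h1.trans h2)
  push_cast
  calc (Nat.log 2 N : ℝ) + 1 ≤ (N : ℝ) ^ ε / ε / Real.log 2 + (N : ℝ) ^ ε := add_le_add h4 h3
    _ = _ := by field_simp; ring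

theorem card_le_of_distinctSubsetProds_s3 {ε : ℝ} (hε : 0 < ε) {N : ℕ} (hN : 0 < N) {A : Finset ℕ}
    (hAN : A ⊆ Finset.Icc 1 N) (hsq : ∀ a ∈ A, Squarefree a) (hA : DistinctSubsetProds A) :
    (A.card : ℝ) ≤ primePi N + (1 / 2) * primePi ((N : ℝ) ^ ((1 : ℝ) / 2)) +
      (5 + 20 * (1 + 1 / (ε / 2 * Real.log 2)) ^ 2) * (N : ℝ) ^ ((5 : ℝ) / 12 + ε) := by
  have hN1 : (1 : ℝ) ≤ N := by exact_mod_cast hN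
  have hN0 : (0 : ℝ) < N := by exact_mod_cast hN
  set c : ℝ := 1 + 1 / (ε / 2 * Real.log 2)
  set x : ℝ := (N : ℝ) ^ ((1 : ℝ) / 12) with hx
  set y : ℝ := (N : ℝ) ^ (ε / 2) with hy
  have hx1 : 1 ≤ x := Real.one_le_rpow hN1 (by norm_num)
  have hy1 : 1 ≤ y := Real.one_le_rpow hN1 (by positivity)
  set K := ⌈x⌉₊
  set m := Nat.log 2 N + 1
  have hKx : x ≤ K := Nat.le_ceil x
  have hKx2 : (K : ℝ) ≤ 2 * x := by
    have := Nat.ceil_lt_add_one (zero_le_one.trans hx1)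
    linarith
  have hK : 0 < K := Nat.ceil_pos.mpr (by linarith)
  have hK1 : (1 : ℝ) ≤ K := by exact_mod_cast hK
  have hm1 : (1 : ℝ) ≤ m := by exact_mod_cast Nat.succ_pos _
  have hmy : (m : ℝ) ≤ c * y := natLog_two_add_one_le (half_pos hε) hN
  have hxpow : ∀ k : ℕ, x ^ k = (N : ℝ) ^ ((k : ℝ) / 12) := fun k => by
    rw [hx, ← Real.rpow_natCast, ← Real.rpow_mul hN0.le]
    ring_nf
  have hQ := card_filter_prime_pow_le N 3 (by norm_num)
  have hP := card_filter_prime_pow_le N 2 (by norm_num)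
  have hmain := two_mul_card_le_of_distinctSubsetProds hK hN (Nat.lt_pow_succ_log_self one_lt_two N)
    hAN hsq hA
  rw [primePi_natCast, primePi_rpow_half]
  set n₁ := ((Finset.Icc 1 N).filter Nat.Prime).card
  set n₂ := ((Finset.Icc 1 N).filter fun p => p.Prime ∧ p ^ 2 ≤ N).card
  set n₃ := ((Finset.Icc 1 N).filter fun p => p.Prime ∧ p ^ 3 ≤ N).card
  have hn₂ : (n₂ : ℝ) ≤ x ^ 6 := by
    rw [hxpow]
    convert hP using 2
    norm_num
  have hn₃ : (n₃ : ℝ) ≤ x ^ 4 := by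
    rw [hxpow]
    convert hQ using 2
    norm_num
  have htarget : (N : ℝ) ^ ((5 : ℝ) / 12 + ε) = x ^ 5 * y ^ 2 := by
    rw [hxpow, hy, ← Real.rpow_natCast, ← Real.rpow_mul hN0.le, ← Real.rpow_add hN0]
    norm_num
  have hx5 : 1 ≤ x ^ 5 := one_le_pow₀ hx1
  have hx6 : 1 ≤ x ^ 6 := one_le_pow₀ hx1
  have hxy : x ^ 5 ≤ x ^ 5 * y ^ 2 := le_mul_of_one_le_right (by positivity) (one_le_pow₀ hy1)
  have hKm : 1 ≤ (K : ℝ) * m := one_le_mul_of_one_le_of_one_le hK1 hm1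
  have hremoved : (n₃ : ℝ) * m * (8 * (K * m) + 2) ≤ 20 * c ^ 2 * (x ^ 5 * y ^ 2) :=
    calc (n₃ : ℝ) * m * (8 * (K * m) + 2) ≤ x ^ 4 * m * (10 * (2 * x * m)) := by
          have : (K : ℝ) * m ≤ 2 * x * m := by gcongr
          gcongr
          linarith
      _ = 20 * x ^ 5 * (m : ℝ) ^ 2 := by ring
      _ ≤ 20 * x ^ 5 * (c * y) ^ 2 := by gcongr
      _ = _ := by ring
  have hcycles : 3 * ((n₂ : ℝ) + 1) ≤ 2 * K * (3 * x ^ 5) :=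
    calc 3 * ((n₂ : ℝ) + 1) ≤ 2 * x * (3 * x ^ 5) := by nlinarith
      _ ≤ 2 * K * (3 * x ^ 5) := by gcongr
  have hmain' : 2 * (K : ℝ) * A.card ≤ 2 * K * (n₁ + 1) + (K + 3) * (n₂ + 1) +
      2 * K * (n₃ * m * (8 * (K * m) + 2)) := by exact_mod_cast hmain
  have h2K : (0 : ℝ) < 2 * K := by positivity
  rw [htarget]
  refine le_of_mul_le_mul_left ?_ h2K
  calc 2 * (K : ℝ) * A.card ≤ 2 * K * (n₁ + 1) + (K + 3) * (n₂ + 1) +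
        2 * K * (n₃ * m * (8 * (K * m) + 2)) := hmain'
    _ ≤ 2 * K * (n₁ + 1) + K * (n₂ + 1) + 2 * K * (3 * x ^ 5) +
        2 * K * (20 * c ^ 2 * (x ^ 5 * y ^ 2)) := by
      have := mul_le_mul_of_nonneg_left hremoved h2K.le
      linarith
    _ = 2 * K * (n₁ + 1 / 2 * n₂ + (3 / 2 + 3 * x ^ 5 + 20 * c ^ 2 * (x ^ 5 * y ^ 2))) := by ring
    _ ≤ 2 * K * (n₁ + 1 / 2 * n₂ + (5 + 20 * c ^ 2) * (x ^ 5 * y ^ 2)) := by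
      refine mul_le_mul_of_nonneg_left ?_ h2K.le
      linarith

lemma exists_card_eq_maxSqfreeDSP (N : ℕ) : ∃ A : Finset ℕ, A ⊆ Finset.Icc 1 N ∧
    (∀ a ∈ A, Squarefree a) ∧ DistinctSubsetProds A ∧ A.card = maxSqfreeDSP N := by
  have hmem : maxSqfreeDSP N ∈ {k | ∃ A : Finset ℕ, ↑A ⊆ Set.Icc 1 N ∧ (∀ a ∈ A, Squarefree a) ∧
      DistinctSubsetProds ↑A ∧ A.card = k} := by
    refine Nat.sSup_mem ⟨0, ∅, by simp, by simp, fun B C hB hC _ => ?_, rfl⟩ ⟨N, ?_⟩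
    · simp only [Finset.coe_empty, Set.subset_empty_iff, Finset.coe_eq_empty] at hB hC
      rw [hB, hC]
    · rintro k ⟨A, hAN, -, -, rfl⟩
      rw [← Finset.coe_Icc, Finset.coe_subset] at hAN
      simpa using Finset.card_le_card hAN
  obtain ⟨A, hAN, hA⟩ := hmem
  rw [← Finset.coe_Icc, Finset.coe_subset] at hAN
  exact ⟨A, hAN, hA⟩

/-- `h(N) ≤ π(N) + (1/2)·π(N^{1/2}) + O(N^{5/12+o(1)})`. -/
theorem stmt3 : ∀ ε : ℝ, 0 < ε → ∃ C : ℝ, 0 < C ∧ ∀ N : ℕ,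
    (maxSqfreeDSP N : ℝ) ≤ primePi N + (1 / 2) * primePi ((N : ℝ) ^ ((1 : ℝ) / 2)) +
      C * (N : ℝ) ^ ((5 : ℝ) / 12 + ε) := by
  intro ε hε
  refine ⟨5 + 20 * (1 + 1 / (ε / 2 * Real.log 2)) ^ 2, by positivity, fun N => ?_⟩
  obtain ⟨A, hAN, hsq, hA, hcard⟩ := exists_card_eq_maxSqfreeDSP N
  rw [← hcard]
  rcases N.eq_zero_or_pos with rfl | hN
  · have hA0 : A.card = 0 := by simpa using hAN
    rw [hA0, Nat.cast_zero]
    positivity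
  · exact card_le_of_distinctSubsetProds_s3 hε hN hAN hsq hA
end
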